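/- arXiv:1802.10057 — 2 statements merged into one kernel-verified Lean document; each statement's English description precedes it below -/
import Mathlib

section
/- Let P be any wave operator on the Misner spacetime, i.e. Pu = t·∂_t²u − 2·∂_x∂_t u + ∂_t u + a·∂_x u + b·∂_t u + c·u with coefficients a, b, c smooth on [0,∞)×ℝ and 2π-periodic in x, and let f be smooth on [0,∞)×ℝ and 2π-periodic in x. Suppose (w^N)_{N∈ℕ} is a family of functions, each smooth on [0,∞)×ℝ and 2π-periodic in x, such that for every N ∈ ℕ, every k ≤ N and every x ∈ ℝ one has ∂_t^k(P w^N − f)(0,x) = 0 and ∂_t^k(w^N − w^{N+1})(0,x) = 0. Then there exists a unique function u, smooth on [0,∞)×ℝ and 2π-periodic in x, such that Pu = f on (0,∞)×ℝ and ∂_t^k u(0,x) = ∂_t^k w^N(0,x) for every N ∈ ℕ, every k ≤ N and every x ∈ ℝ. -/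
/-- Partial derivative in the first (time) variable. -/
noncomputable def pt (u : ℝ → ℝ → ℝ) : ℝ → ℝ → ℝ := fun t x => deriv (fun s => u s x) t

/-- Partial derivative in the second (space) variable. -/
noncomputable def px (u : ℝ → ℝ → ℝ) : ℝ → ℝ → ℝ := fun t x => deriv (fun y => u t y) x

/-- Smooth up to the boundary `t = 0`, modelled as the restriction of a smooth
function on `ℝ²`. -/
def Smooth2 (u : ℝ → ℝ → ℝ) : Prop := ContDiff ℝ (⊤ : ℕ∞) (fun p : ℝ × ℝ => u p.1 p.2)

/-- `2π`-periodicity in the second variable. -/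
def Periodic2 (u : ℝ → ℝ → ℝ) : Prop := ∀ t x : ℝ, u t (x + 2 * Real.pi) = u t x

/-- A general scalar wave operator on the Misner spacetime:
`Pu = t·∂ₜ²u − 2·∂ₓ∂ₜu + ∂ₜu + a·∂ₓu + b·∂ₜu + c·u`. -/
noncomputable def MisnerP (a b c u : ℝ → ℝ → ℝ) : ℝ → ℝ → ℝ := fun t x =>
  t * pt (pt u) t x - 2 * px (pt u) t x + pt u t x
    + a t x * px u t x + b t x * pt u t x + c t x * u t x

namespace Misner

set_option linter.unusedSectionVars false

open Set Filter Topology MeasureTheory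
open scoped ContDiff

section Control

variable {E F : Type} [NormedAddCommGroup E] [NormedSpace ℝ E]
  [NormedAddCommGroup F] [NormedSpace ℝ F]

/-- `f` is `O(exp (n s))` on every half-plane `{s ≤ S}`, uniformly in the second variable. -/
def ExpBound (n : ℝ) (f : ℝ × ℝ → E) : Prop :=
  ∀ S : ℝ, ∃ C : ℝ, ∀ p : ℝ × ℝ, p.1 ≤ S → ‖f p‖ ≤ C * Real.exp (n * p.1)

/-- `f` is `k` times differentiable and its derivatives of order at most `k` are
`O(exp (n s))` on every half-plane `{s ≤ S}`. -/
def ExpControl (n : ℝ) : ℕ → ∀ {E : Type} [NormedAddCommGroup E] [NormedSpace ℝ E],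
    (ℝ × ℝ → E) → Prop
  | 0, _, _, _, f => Continuous f ∧ ExpBound n f
  | k + 1, _, _, _, f => Differentiable ℝ f ∧ ExpBound n f ∧ ExpControl n k (fderiv ℝ f)

theorem ExpBound.add {n : ℝ} {f g : ℝ × ℝ → E} (hf : ExpBound n f) (hg : ExpBound n g) :
    ExpBound n (fun p => f p + g p) := by
  intro S
  obtain ⟨C, hC⟩ := hf S
  obtain ⟨D, hD⟩ := hg S
  refine ⟨C + D, fun p hp => (norm_add_le _ _).trans ?_⟩
  rw [add_mul]
  exact add_le_add (hC p hp) (hD p hp)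

theorem ExpBound.clm {n : ℝ} {f : ℝ × ℝ → E} (hf : ExpBound n f) (L : E →L[ℝ] F) :
    ExpBound n (fun p => L (f p)) := by
  intro S
  obtain ⟨C, hC⟩ := hf S
  refine ⟨‖L‖ * C, fun p hp => (L.le_opNorm _).trans ?_⟩
  rw [mul_assoc]
  exact mul_le_mul_of_nonneg_left (hC p hp) (norm_nonneg _)

theorem ExpBound.of_le {n m : ℝ} (hnm : n ≤ m) {f : ℝ × ℝ → E} (hf : ExpBound m f) :
    ExpBound n f := by
  intro S
  obtain ⟨C, hC⟩ := hf S
  have h0 : 0 ≤ C := nonneg_of_mul_nonneg_left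
    ((norm_nonneg _).trans (hC (S, 0) le_rfl)) (Real.exp_pos _)
  refine ⟨C * Real.exp ((m - n) * S), fun p hp => (hC p hp).trans ?_⟩
  rw [mul_assoc, ← Real.exp_add]
  gcongr
  nlinarith

theorem ExpBound.clm_apply {n : ℝ} {m : ℝ × ℝ → E →L[ℝ] F} {f : ℝ × ℝ → E}
    (hm : ExpBound 0 m) (hf : ExpBound n f) : ExpBound n (fun p => m p (f p)) := by
  intro S
  obtain ⟨C, hC⟩ := hm S
  obtain ⟨D, hD⟩ := hf S
  refine ⟨C * D, fun p hp => ((m p).le_opNorm _).trans ?_⟩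
  have h1 : ‖m p‖ ≤ C := by simpa using hC p hp
  rw [mul_assoc]
  exact mul_le_mul h1 (hD p hp) (norm_nonneg _) ((norm_nonneg _).trans h1)

theorem ExpControl.continuous {n : ℝ} {k : ℕ} {f : ℝ × ℝ → E} (h : ExpControl n k f) :
    Continuous f := by
  cases k with
  | zero => exact h.1
  | succ k => exact h.1.continuous

theorem ExpControl.expBound {n : ℝ} {k : ℕ} {f : ℝ × ℝ → E} (h : ExpControl n k f) :
    ExpBound n f := by
  cases k with
  | zero => exact h.2
  | succ k => exact h.2.1

theorem ExpControl.of_succ {n : ℝ} {k : ℕ} {f : ℝ × ℝ → E} (h : ExpControl n (k + 1) f) :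
    ExpControl n k f := by
  induction k generalizing E with
  | zero => exact ⟨h.continuous, h.expBound⟩
  | succ k ih => exact ⟨h.1, h.2.1, ih h.2.2⟩

theorem ExpControl.zero {n : ℝ} {k : ℕ} {f : ℝ × ℝ → E} (h : ExpControl n k f) :
    ExpControl n 0 f := ⟨h.continuous, h.expBound⟩

theorem ExpControl.add {n : ℝ} {k : ℕ} {f g : ℝ × ℝ → E} (hf : ExpControl n k f)
    (hg : ExpControl n k g) : ExpControl n k (fun p => f p + g p) := by
  induction k generalizing E with
  | zero => exact ⟨hf.1.add hg.1, hf.2.add hg.2⟩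
  | succ k ih =>
    refine ⟨hf.1.add hg.1, hf.2.1.add hg.2.1, ?_⟩
    have : fderiv ℝ (fun p => f p + g p) = fun p => fderiv ℝ f p + fderiv ℝ g p := by
      ext1 p
      exact fderiv_fun_add (hf.1 p) (hg.1 p)
    rw [this]
    exact ih hf.2.2 hg.2.2

theorem ExpControl.clm {n : ℝ} {k : ℕ} {f : ℝ × ℝ → E} (hf : ExpControl n k f)
    (L : E →L[ℝ] F) : ExpControl n k (fun p => L (f p)) := by
  induction k generalizing E F with
  | zero => exact ⟨L.continuous.comp hf.1, hf.2.clm L⟩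
  | succ k ih =>
    refine ⟨L.differentiable.comp hf.1, hf.2.1.clm L, ?_⟩
    have : fderiv ℝ (fun p => L (f p)) =
        fun p => ContinuousLinearMap.compL ℝ (ℝ × ℝ) E F L (fderiv ℝ f p) := by
      ext1 p
      exact (L.hasFDerivAt.comp p (hf.1 p).hasFDerivAt).fderiv
    rw [this]
    exact ih hf.2.2 _

end Control

section RayIntegral

variable {E F : Type} [NormedAddCommGroup E] [NormedSpace ℝ E]
  [NormedAddCommGroup F] [NormedSpace ℝ F]

/-- Integral of `f` over the backward ray in the direction `(1, -l)`: it inverts `∂ₛ - l ∂ₓ`. -/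
noncomputable def rayInt (l : ℝ) (f : ℝ × ℝ → E) (p : ℝ × ℝ) : E :=
  ∫ r in Ioi (0 : ℝ), f (p - r • ((1 : ℝ), -l))

theorem integrableOn_exp_sub {n : ℝ} (hn : 0 < n) (C s : ℝ) :
    IntegrableOn (fun r : ℝ => C * Real.exp (n * (s - r))) (Ioi 0) := by
  have h := (integrableOn_exp_mul_Ioi (neg_lt_zero.2 hn) 0).const_mul (C * Real.exp (n * s))
  refine h.congr (ae_of_all _ fun r => ?_)
  simp only [mul_assoc, ← Real.exp_add]
  congr 2
  ring

theorem integral_exp_sub {n : ℝ} (hn : 0 < n) (C s : ℝ) :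
    ∫ r in Ioi (0 : ℝ), C * Real.exp (n * (s - r)) = C / n * Real.exp (n * s) := by
  have h : ∀ r : ℝ, C * Real.exp (n * (s - r)) = C * Real.exp (n * s) * Real.exp (-n * r) := by
    intro r
    rw [mul_assoc, ← Real.exp_add]
    congr 2
    ring
  simp_rw [h, integral_const_mul, integral_exp_mul_Ioi (neg_lt_zero.2 hn)]
  simp
  field_simp

theorem norm_rayInt_le {n : ℝ} (hn : 0 < n) {S C : ℝ} {f : ℝ × ℝ → E}
    (hf : ∀ p : ℝ × ℝ, p.1 ≤ S → ‖f p‖ ≤ C * Real.exp (n * p.1)) (l : ℝ) (p : ℝ × ℝ)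
    (hp : p.1 ≤ S) : ‖rayInt l f p‖ ≤ C / n * Real.exp (n * p.1) := by
  rw [← integral_exp_sub hn]
  refine norm_integral_le_of_norm_le (integrableOn_exp_sub hn C p.1) ?_
  filter_upwards [ae_restrict_mem measurableSet_Ioi] with r hr
  have hr' : (0 : ℝ) < r := hr
  simpa using hf (p - r • ((1 : ℝ), -l)) (by simp; linarith)

theorem integrableOn_ray {n : ℝ} (hn : 0 < n) {f : ℝ × ℝ → E} (hf : Continuous f)
    (hb : ExpBound n f) (l : ℝ) (p : ℝ × ℝ) :
    IntegrableOn (fun r : ℝ => f (p - r • ((1 : ℝ), -l))) (Ioi 0) := by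
  obtain ⟨C, hC⟩ := hb p.1
  refine (integrableOn_exp_sub hn C p.1).mono'
    (Continuous.aestronglyMeasurable (by fun_prop)) ?_
  filter_upwards [ae_restrict_mem measurableSet_Ioi] with r hr
  have hr' : (0 : ℝ) < r := hr
  simpa using hC (p - r • ((1 : ℝ), -l)) (by simp; linarith)

theorem bound_near {n : ℝ} (hn : 0 < n) {f : ℝ × ℝ → E} (hb : ExpBound n f) (l : ℝ)
    (p : ℝ × ℝ) : ∃ C : ℝ, ∀ q ∈ {q : ℝ × ℝ | q.1 < p.1 + 1}, ∀ r ∈ Ioi (0 : ℝ),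
      ‖f (q - r • ((1 : ℝ), -l))‖ ≤ C * Real.exp (n * (p.1 + 1 - r)) := by
  obtain ⟨C, hC⟩ := hb (p.1 + 1)
  have h0 : 0 ≤ C := nonneg_of_mul_nonneg_left
    ((norm_nonneg _).trans (hC (p.1 + 1, 0) le_rfl)) (Real.exp_pos _)
  refine ⟨C, fun q hq r hr => ?_⟩
  have hr' : (0 : ℝ) < r := hr
  have hq' : q.1 < p.1 + 1 := hq
  refine (hC (q - r • ((1 : ℝ), -l)) (by simp; linarith)).trans ?_
  gcongr
  simp
  linarith

theorem halfPlane_mem_nhds (p : ℝ × ℝ) : {q : ℝ × ℝ | q.1 < p.1 + 1} ∈ 𝓝 p :=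
  (isOpen_lt continuous_fst continuous_const).mem_nhds (by simp)

theorem continuous_rayInt {n : ℝ} (hn : 0 < n) {f : ℝ × ℝ → E} (hf : Continuous f)
    (hb : ExpBound n f) (l : ℝ) : Continuous (rayInt l f) := by
  refine continuous_iff_continuousAt.2 fun p => ?_
  obtain ⟨C, hC⟩ := bound_near hn hb l p
  refine continuousAt_of_dominated (bound := fun r => C * Real.exp (n * (p.1 + 1 - r)))
    (Eventually.of_forall fun q => Continuous.aestronglyMeasurable (by fun_prop)) ?_
    (integrableOn_exp_sub hn C _) (ae_of_all _ fun r => by fun_prop)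
  filter_upwards [halfPlane_mem_nhds p] with q hq
  filter_upwards [ae_restrict_mem measurableSet_Ioi] with r hr using hC q hq r hr

theorem hasFDerivAt_rayInt {n : ℝ} (hn : 0 < n) {f : ℝ × ℝ → E} (hf : ExpControl n 1 f)
    (l : ℝ) (p : ℝ × ℝ) : HasFDerivAt (rayInt l f) (rayInt l (fderiv ℝ f) p) p := by
  have hf' : Continuous (fderiv ℝ f) := hf.2.2.1
  have hc := hf.continuous
  obtain ⟨C, hC⟩ := bound_near hn hf.2.2.2 l p
  refine hasFDerivAt_integral_of_dominated_of_fderiv_le (halfPlane_mem_nhds p)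
    (bound := fun r => C * Real.exp (n * (p.1 + 1 - r)))
    (F := fun q r => f (q - r • ((1 : ℝ), -l)))
    (F' := fun q r => fderiv ℝ f (q - r • ((1 : ℝ), -l)))
    (Eventually.of_forall fun q => Continuous.aestronglyMeasurable (by fun_prop))
    (integrableOn_ray hn hc hf.expBound l p)
    (Continuous.aestronglyMeasurable (by fun_prop)) ?_
    (integrableOn_exp_sub hn C _) (ae_of_all _ fun r q _ => ?_)
  · filter_upwards [ae_restrict_mem measurableSet_Ioi] with r hr q hq using hC q hq r hr
  · exact (hf.1 _).hasFDerivAt.comp q ((hasFDerivAt_id q).sub_const _)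

theorem ExpBound.rayInt {n : ℝ} (hn : 0 < n) {f : ℝ × ℝ → E} (hb : ExpBound n f) (l : ℝ) :
    ExpBound n (rayInt l f) := by
  intro S
  obtain ⟨C, hC⟩ := hb S
  exact ⟨C / n, fun p hp => norm_rayInt_le hn hC l p hp⟩

theorem ExpControl.rayInt {n : ℝ} (hn : 0 < n) {k : ℕ} {f : ℝ × ℝ → E}
    (hf : ExpControl n k f) (l : ℝ) : ExpControl n k (rayInt l f) := by
  induction k generalizing E with
  | zero => exact ⟨continuous_rayInt hn hf.1 hf.2 l, hf.2.rayInt hn l⟩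
  | succ k ih =>
    have h1 : ExpControl n 1 f := ⟨hf.1, hf.2.1, hf.2.2.zero⟩
    have h := hasFDerivAt_rayInt hn h1 l
    refine ⟨fun p => (h p).differentiableAt, hf.2.1.rayInt hn l, ?_⟩
    have : fderiv ℝ (Misner.rayInt l f) = Misner.rayInt l (fderiv ℝ f) := by
      ext1 p
      exact (h p).fderiv
    rw [this]
    exact ih hf.2.2

theorem clm_rayInt [CompleteSpace E] [CompleteSpace F] {n : ℝ} (hn : 0 < n) {f : ℝ × ℝ → E}
    (hf : Continuous f) (hb : ExpBound n f) (L : E →L[ℝ] F) (l : ℝ) (p : ℝ × ℝ) :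
    rayInt l (fun q => L (f q)) p = L (rayInt l f p) :=
  L.integral_comp_comm (integrableOn_ray hn hf hb l p)

/-- Fundamental theorem of calculus along a backward ray. -/
theorem rayInt_directional [CompleteSpace E] {n : ℝ} (hn : 0 < n) {f : ℝ × ℝ → E}
    (hf : ExpControl n 1 f) (l : ℝ) (p : ℝ × ℝ) :
    rayInt l (fun q => fderiv ℝ f q ((1 : ℝ), -l)) p = f p := by
  have hd : ExpControl n 0 (fun q => fderiv ℝ f q ((1 : ℝ), -l)) :=
    hf.2.2.clm (ContinuousLinearMap.apply ℝ E ((1 : ℝ), -l))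
  have hint := integrableOn_ray hn hd.1 hd.2 l p
  have hderiv : ∀ r ∈ Ici (0 : ℝ), HasDerivAt (fun r : ℝ => -f (p - r • ((1 : ℝ), -l)))
      (fderiv ℝ f (p - r • ((1 : ℝ), -l)) ((1 : ℝ), -l)) r := by
    intro r _
    have h1 : HasDerivAt (fun r : ℝ => p - r • ((1 : ℝ), -l)) (-((1 : ℝ), -l)) r := by
      simpa using ((hasDerivAt_id r).smul_const ((1 : ℝ), -l)).const_sub p
    refine ((hf.1 (p - r • ((1 : ℝ), -l))).hasFDerivAt.comp_hasDerivAt r h1).neg.congr_deriv ?_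
    rw [map_neg, neg_neg]
  have hlim : Tendsto (fun r : ℝ => -f (p - r • ((1 : ℝ), -l))) atTop (𝓝 0) := by
    obtain ⟨C, hC⟩ := hf.expBound p.1
    have hexp : Tendsto (fun r : ℝ => C * Real.exp (n * (p.1 - r))) atTop (𝓝 0) := by
      have h3 : Tendsto (fun r : ℝ => n * (p.1 - r)) atTop atBot :=
        Tendsto.const_mul_atBot hn (tendsto_atBot_add_const_left _ _ tendsto_neg_atTop_atBot)
      simpa using (Real.tendsto_exp_atBot.comp h3).const_mul C
    refine squeeze_zero_norm' ?_ hexp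
    filter_upwards [eventually_ge_atTop 0] with r hr
    simpa using hC (p - r • ((1 : ℝ), -l)) (by simpa using hr)
  have := integral_Ioi_of_hasDerivAt_of_tendsto' hderiv hint hlim
  simpa [rayInt] using this

/-- `rayInt l` is a right inverse of `∂ₛ - l ∂ₓ`. -/
theorem fderiv_rayInt_directional [CompleteSpace E] {n : ℝ} (hn : 0 < n) {f : ℝ × ℝ → E}
    (hf : ExpControl n 1 f) (l : ℝ) (p : ℝ × ℝ) :
    fderiv ℝ (rayInt l f) p ((1 : ℝ), -l) = f p := by
  rw [(hasFDerivAt_rayInt hn hf l p).fderiv, ← rayInt_directional hn hf l p]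
  exact (clm_rayInt hn hf.2.2.1 hf.2.2.2
    (ContinuousLinearMap.apply ℝ E ((1 : ℝ), -l)) l p).symm

end RayIntegral

section RayIntegrals

variable {E F : Type} [NormedAddCommGroup E] [NormedSpace ℝ E]
  [NormedAddCommGroup F] [NormedSpace ℝ F]

/-- Composite of the ray integrals with the slopes in the list `ls`. -/
noncomputable def rayInts (ls : List ℝ) (f : ℝ × ℝ → E) : ℝ × ℝ → E :=
  ls.foldr (fun l g => rayInt l g) f

theorem ExpControl.rayInts {n : ℝ} (hn : 0 < n) {k : ℕ} {f : ℝ × ℝ → E}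
    (hf : ExpControl n k f) (ls : List ℝ) : ExpControl n k (rayInts ls f) := by
  induction ls with
  | nil => exact hf
  | cons l ls ih => exact ih.rayInt hn l

theorem norm_rayInts_le {n : ℝ} (hn : 1 ≤ n) {S C : ℝ} (hC0 : 0 ≤ C) {f : ℝ × ℝ → E}
    (hf : ∀ p : ℝ × ℝ, p.1 ≤ S → ‖f p‖ ≤ C * Real.exp (n * p.1)) {ls : List ℝ}
    (hls : ls ≠ []) (p : ℝ × ℝ) (hp : p.1 ≤ S) :
    ‖rayInts ls f p‖ ≤ C / n * Real.exp (n * p.1) := by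
  have h0 : 0 < n := by linarith
  induction ls generalizing p with
  | nil => exact absurd rfl hls
  | cons l ls ih =>
    rcases eq_or_ne ls [] with rfl | h
    · exact norm_rayInt_le h0 hf l p hp
    · refine norm_rayInt_le h0 (fun q hq => (ih h q hq).trans ?_) l p hp
      gcongr
      exact div_le_self hC0 hn

theorem hasFDerivAt_rayInts {n : ℝ} (hn : 0 < n) {f : ℝ × ℝ → E} (hf : ExpControl n 1 f)
    (ls : List ℝ) (p : ℝ × ℝ) :
    HasFDerivAt (rayInts ls f) (rayInts ls (fderiv ℝ f) p) p := by
  induction ls generalizing p with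
  | nil => exact (hf.1 p).hasFDerivAt
  | cons l ls ih =>
    have h := hasFDerivAt_rayInt hn (hf.rayInts hn ls) l p
    have h2 : fderiv ℝ (rayInts ls f) = rayInts ls (fderiv ℝ f) := by
      ext1 q
      exact (ih q).fderiv
    rwa [h2] at h

theorem clm_rayInts [CompleteSpace E] [CompleteSpace F] {n : ℝ} (hn : 0 < n)
    {f : ℝ × ℝ → E} (hf : ExpControl n 0 f) (L : E →L[ℝ] F) (ls : List ℝ) (p : ℝ × ℝ) :
    rayInts ls (fun q => L (f q)) p = L (rayInts ls f p) := by
  induction ls generalizing p with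
  | nil => rfl
  | cons l ls ih =>
    have h2 : rayInts ls (fun q => L (f q)) = fun q => L (rayInts ls f q) := by
      ext1 q
      exact ih q
    have h3 := hf.rayInts hn ls
    change rayInt l (rayInts ls (fun q => L (f q))) p = L (rayInt l (rayInts ls f) p)
    rw [h2]
    exact clm_rayInt hn h3.1 h3.2 L l p

theorem rayInt_periodic {f : ℝ × ℝ → E} {v : ℝ × ℝ} (hf : ∀ p, f (p + v) = f p) (l : ℝ)
    (p : ℝ × ℝ) : rayInt l f (p + v) = rayInt l f p := by
  simp only [rayInt, add_sub_right_comm, hf]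

theorem rayInts_periodic {f : ℝ × ℝ → E} {v : ℝ × ℝ} (hf : ∀ p, f (p + v) = f p)
    (ls : List ℝ) (p : ℝ × ℝ) : rayInts ls f (p + v) = rayInts ls f p := by
  induction ls generalizing p with
  | nil => exact hf p
  | cons l ls ih => exact rayInt_periodic ih l p

theorem ExpBound.tsum_const {n : ℝ} {f : ℕ → ℝ × ℝ → E}
    (hb : ∀ S : ℝ, ∃ C : ℝ, ∀ j, ∀ p : ℝ × ℝ, p.1 ≤ S →
      ‖f j p‖ ≤ C * (1 / 2) ^ j * Real.exp (n * p.1)) :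
    ExpBound n (fun p => ∑' j, f j p) := by
  intro S
  obtain ⟨C, hC⟩ := hb S
  refine ⟨C * 2, fun p hp => ?_⟩
  exact tsum_of_norm_bounded ((hasSum_geometric_two.mul_left C).mul_right _)
    (fun j => hC j p hp)

theorem continuous_tsum_of_geometric [CompleteSpace E] {n : ℝ} (hn : 0 ≤ n)
    {f : ℕ → ℝ × ℝ → E} (hf : ∀ j, Continuous (f j))
    (hb : ∀ S : ℝ, ∃ C : ℝ, ∀ j, ∀ p : ℝ × ℝ, p.1 ≤ S →
      ‖f j p‖ ≤ C * (1 / 2) ^ j * Real.exp (n * p.1)) :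
    Continuous (fun p => ∑' j, f j p) := by
  refine continuous_iff_continuousAt.2 fun p => ?_
  obtain ⟨C, hC⟩ := hb (p.1 + 1)
  have h0 : 0 ≤ C := nonneg_of_mul_nonneg_left
    (by simpa using (norm_nonneg _).trans (hC 0 (p.1 + 1, 0) le_rfl)) (Real.exp_pos _)
  refine ContinuousOn.continuousAt (s := {q : ℝ × ℝ | q.1 < p.1 + 1}) ?_ (halfPlane_mem_nhds p)
  refine continuousOn_tsum (fun j => (hf j).continuousOn)
    ((summable_geometric_two.mul_left C).mul_right (Real.exp (n * (p.1 + 1)))) ?_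
  intro j q hq
  have hq' : q.1 < p.1 + 1 := hq
  refine (hC j q hq'.le).trans ?_
  gcongr

theorem rayInt_tsum [CompleteSpace E] {n : ℝ} (hn : 0 < n) {f : ℕ → ℝ × ℝ → E}
    (hf : ∀ j, Continuous (f j))
    (hb : ∀ S : ℝ, ∃ C : ℝ, ∀ j, ∀ p : ℝ × ℝ, p.1 ≤ S →
      ‖f j p‖ ≤ C * (1 / 2) ^ j * Real.exp (n * p.1)) (l : ℝ) (p : ℝ × ℝ) :
    rayInt l (fun q => ∑' j, f j q) p = ∑' j, rayInt l (f j) p := by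
  obtain ⟨C, hC⟩ := hb p.1
  have hfb : ∀ j, ExpBound n (f j) := by
    intro j S
    obtain ⟨D, hD⟩ := hb S
    exact ⟨_, hD j⟩
  have hint : ∀ j, IntegrableOn (fun r : ℝ => f j (p - r • ((1 : ℝ), -l))) (Ioi 0) :=
    fun j => integrableOn_ray hn (hf j) (hfb j) l p
  refine (hasSum_integral_of_summable_integral_norm hint ?_).tsum_eq.symm
  refine Summable.of_nonneg_of_le (fun j => integral_nonneg fun r => norm_nonneg _)
    (fun j => ?_) ((summable_geometric_two.mul_left C).mul_right (1 / n * Real.exp (n * p.1)))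
  have h1 : ∀ j : ℕ, C * (1 / 2) ^ j * (1 / n * Real.exp (n * p.1)) =
      C * (1 / 2) ^ j / n * Real.exp (n * p.1) := fun j => by ring
  rw [h1, ← integral_exp_sub hn]
  refine setIntegral_mono_on (hint j).norm (integrableOn_exp_sub hn _ _) measurableSet_Ioi ?_
  intro r hr
  have hr' : (0 : ℝ) < r := hr
  simpa using hC j (p - r • ((1 : ℝ), -l)) (by simp; linarith)

theorem rayInts_tsum [CompleteSpace E] {n : ℝ} (hn : 0 < n) {f : ℕ → ℝ × ℝ → E}
    (hf : ∀ j, Continuous (f j))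
    (hb : ∀ S : ℝ, ∃ C : ℝ, ∀ j, ∀ p : ℝ × ℝ, p.1 ≤ S →
      ‖f j p‖ ≤ C * (1 / 2) ^ j * Real.exp (n * p.1)) (ls : List ℝ) :
    (∀ S : ℝ, ∃ C : ℝ, ∀ j, ∀ p : ℝ × ℝ, p.1 ≤ S →
      ‖rayInts ls (f j) p‖ ≤ C * (1 / 2) ^ j * Real.exp (n * p.1)) ∧
    ∀ p, rayInts ls (fun q => ∑' j, f j q) p = ∑' j, rayInts ls (f j) p := by
  induction ls with
  | nil => exact ⟨hb, fun p => rfl⟩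
  | cons l ls ih =>
    obtain ⟨ih1, ih2⟩ := ih
    refine ⟨fun S => ?_, fun p => ?_⟩
    · obtain ⟨C, hC⟩ := ih1 S
      refine ⟨C / n, fun j p hp => ?_⟩
      have := norm_rayInt_le hn (hC j) l p hp
      rwa [mul_div_right_comm] at this
    · have h2 : rayInts ls (fun q => ∑' j, f j q) = fun q => ∑' j, rayInts ls (f j) q := by
        ext1 q
        exact ih2 q
      change rayInt l (rayInts ls (fun q => ∑' j, f j q)) p = _
      rw [h2]
      refine rayInt_tsum hn (fun j => ?_) ih1 l p
      have hfb : ExpBound n (f j) := by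
        intro S
        obtain ⟨D, hD⟩ := hb S
        exact ⟨_, hD j⟩
      have h0 : ExpControl n 0 (f j) := ⟨hf j, hfb⟩
      exact (h0.rayInts hn ls).1

end RayIntegrals

section Picard

variable {E : Type} [NormedAddCommGroup E] [NormedSpace ℝ E] {ι : Type} [Fintype ι]

/-- Picard iterates (increments) of the equation `Z = G + ∑ k, m k (rayInts (ls k) Z)`. -/
noncomputable def picard (ls : ι → List ℝ) (m : ι → ℝ × ℝ → E →L[ℝ] E) (G : ℝ × ℝ → E) :
    ℕ → ℝ × ℝ → E
  | 0 => G
  | j + 1 => fun p => ∑ k, m k p (rayInts (ls k) (picard ls m G j) p)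

/-- The solution of `Z = G + ∑ k, m k (rayInts (ls k) Z)`. -/
noncomputable def picardSum (ls : ι → List ℝ) (m : ι → ℝ × ℝ → E →L[ℝ] E)
    (G : ℝ × ℝ → E) (p : ℝ × ℝ) : E := ∑' j, picard ls m G j p

variable {ls : ι → List ℝ} {m : ι → ℝ × ℝ → E →L[ℝ] E} {G : ℝ × ℝ → E}

theorem ExpBound.sum_coeff_le (hm : ∀ k, ExpBound 0 (m k)) (S : ℝ) :
    ∃ C : ℝ, 0 ≤ C ∧ ∀ p : ℝ × ℝ, p.1 ≤ S → ∑ k, ‖m k p‖ ≤ C := by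
  choose D hD using fun k => hm k S
  have h : ∀ p : ℝ × ℝ, p.1 ≤ S → ∑ k, ‖m k p‖ ≤ ∑ k, D k := by
    intro p hp
    refine Finset.sum_le_sum fun k _ => ?_
    simpa using hD k p hp
  exact ⟨∑ k, D k, (Finset.sum_nonneg fun k _ => norm_nonneg (m k (S, 0))).trans
    (h (S, 0) le_rfl), h⟩

theorem norm_sum_rayInts_le (hls : ∀ k, ls k ≠ []) {S C A n : ℝ} (hA : 0 ≤ A)
    (hC : ∀ p : ℝ × ℝ, p.1 ≤ S → ∑ k, ‖m k p‖ ≤ C) (hn : 1 ≤ n) (hnC : 2 * C ≤ n)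
    {f : ℝ × ℝ → E} (hf : ∀ p : ℝ × ℝ, p.1 ≤ S → ‖f p‖ ≤ A * Real.exp (n * p.1))
    (p : ℝ × ℝ) (hp : p.1 ≤ S) :
    ‖∑ k, m k p (rayInts (ls k) f p)‖ ≤ A * (1 / 2) * Real.exp (n * p.1) := by
  have hn0 : 0 < n := by linarith
  calc ‖∑ k, m k p (rayInts (ls k) f p)‖
      ≤ ∑ k, ‖m k p‖ * (A / n * Real.exp (n * p.1)) := by
        refine norm_sum_le_of_le _ fun k _ => ((m k p).le_opNorm _).trans ?_
        gcongr
        exact norm_rayInts_le hn hA hf (hls k) p hp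
    _ = (∑ k, ‖m k p‖) * (A / n * Real.exp (n * p.1)) := by rw [Finset.sum_mul]
    _ ≤ n / 2 * (A / n * Real.exp (n * p.1)) := by
        gcongr
        linarith [hC p hp]
    _ = A * (1 / 2) * Real.exp (n * p.1) := by field_simp

theorem norm_picard_le (hls : ∀ k, ls k ≠ []) (hm : ∀ k, ExpBound 0 (m k))
    (hG : ∀ n, ExpBound n G) (n S : ℝ) : ∃ C : ℝ, ∀ j, ∀ p : ℝ × ℝ, p.1 ≤ S →
      ‖picard ls m G j p‖ ≤ C * (1 / 2) ^ j * Real.exp (n * p.1) := by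
  obtain ⟨C, hC0, hC⟩ := ExpBound.sum_coeff_le hm S
  obtain ⟨N, hN1, hNC, hNn⟩ : ∃ N : ℝ, 1 ≤ N ∧ 2 * C ≤ N ∧ n ≤ N :=
    ⟨max 1 (max (2 * C) n), by simp, by simp, by simp⟩
  obtain ⟨A, hA⟩ := hG N S
  have hA0 : 0 ≤ A := nonneg_of_mul_nonneg_left
    ((norm_nonneg _).trans (hA (S, 0) le_rfl)) (Real.exp_pos _)
  have key : ∀ j, ∀ p : ℝ × ℝ, p.1 ≤ S →
      ‖picard ls m G j p‖ ≤ A * (1 / 2) ^ j * Real.exp (N * p.1) := by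
    intro j
    induction j with
    | zero => simpa [picard] using hA
    | succ j ih =>
      intro p hp
      rw [pow_succ, ← mul_assoc]
      exact norm_sum_rayInts_le hls (by positivity) hC hN1 hNC ih p hp
  refine ⟨A * Real.exp ((N - n) * S), fun j p hp => (key j p hp).trans ?_⟩
  have : A * Real.exp ((N - n) * S) * (1 / 2) ^ j * Real.exp (n * p.1) =
      A * (1 / 2) ^ j * Real.exp ((N - n) * S + n * p.1) := by
    rw [Real.exp_add]
    ring
  rw [this]
  gcongr
  nlinarith

theorem ExpControl.picard {n : ℝ} (hn : 0 < n) (hm : ∀ k, ExpControl 0 0 (m k))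
    (hG : ExpControl n 0 G) (j : ℕ) : ExpControl n 0 (picard ls m G j) := by
  induction j with
  | zero => exact hG
  | succ j ih =>
    have h : ∀ k,
        ExpControl n 0 (fun p => m k p (Misner.rayInts (ls k) (Misner.picard ls m G j) p)) :=
      fun k => ⟨(hm k).1.clm_apply (ih.rayInts hn (ls k)).1,
        (hm k).2.clm_apply (ih.rayInts hn (ls k)).2⟩
    refine ⟨continuous_finsetSum _ fun k _ => (h k).1, ?_⟩
    change ExpBound n (fun p => ∑ k, m k p (Misner.rayInts (ls k) (Misner.picard ls m G j) p))
    have : ∀ s : Finset ι, ExpBound n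
        (fun p => ∑ k ∈ s, m k p (Misner.rayInts (ls k) (Misner.picard ls m G j) p)) := by
      classical
      intro s
      induction s using Finset.induction_on with
      | empty => exact fun S => ⟨0, by simp⟩
      | insert k s hk ihs =>
        simp only [Finset.sum_insert hk]
        exact (h k).2.add ihs
    exact this _

theorem picardSum_flat_zero [CompleteSpace E] (hls : ∀ k, ls k ≠ [])
    (hm : ∀ k, ExpControl 0 0 (m k)) (hG : ∀ n, ExpControl n 0 G) (n : ℝ) :
    ExpControl n 0 (picardSum ls m G) := by
  have hb := norm_picard_le hls (fun k => (hm k).2) fun n => (hG n).2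
  exact ⟨continuous_tsum_of_geometric zero_le_one
    (fun j => (ExpControl.picard zero_lt_one hm (hG 1) j).1) (hb 1),
    ExpBound.tsum_const (hb n)⟩

theorem summable_of_geometric [CompleteSpace E] {n : ℝ} {f : ℕ → ℝ × ℝ → E}
    (hb : ∀ S : ℝ, ∃ C : ℝ, ∀ j, ∀ p : ℝ × ℝ, p.1 ≤ S →
      ‖f j p‖ ≤ C * (1 / 2) ^ j * Real.exp (n * p.1)) (p : ℝ × ℝ) :
    Summable fun j => f j p := by
  obtain ⟨C, hC⟩ := hb p.1
  exact Summable.of_norm_bounded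
    ((summable_geometric_two.mul_left C).mul_right (Real.exp (n * p.1))) fun j => hC j p le_rfl

theorem picardSum_eq [CompleteSpace E] (hls : ∀ k, ls k ≠ [])
    (hm : ∀ k, ExpControl 0 0 (m k)) (hG : ∀ n, ExpControl n 0 G) (p : ℝ × ℝ) :
    picardSum ls m G p = G p + ∑ k, m k p (rayInts (ls k) (picardSum ls m G) p) := by
  have hb := norm_picard_le hls (fun k => (hm k).2) (fun n => (hG n).2) 1
  have hc : ∀ j, Continuous (picard ls m G j) :=
    fun j => (ExpControl.picard zero_lt_one hm (hG 1) j).1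
  have hr := fun k => rayInts_tsum zero_lt_one hc hb (ls k)
  have hsum := summable_of_geometric hb p
  have h1 : ∀ k, HasSum (fun j => m k p (rayInts (ls k) (picard ls m G j) p))
      (m k p (rayInts (ls k) (picardSum ls m G) p)) := by
    intro k
    have h2 : rayInts (ls k) (picardSum ls m G) p = _ := (hr k).2 p
    rw [h2]
    exact (m k p).hasSum (summable_of_geometric (hr k).1 p).hasSum
  have h3 := hasSum_sum (s := Finset.univ) fun k _ => h1 k
  rw [picardSum, hsum.tsum_eq_zero_add]
  congr 1
  exact h3.tsum_eq

/-- The equation `Z = ∑ k, m k (rayInts (ls k) Z)` has no nonzero solution vanishing to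
infinite order. -/
theorem eq_zero_of_eq_sum_rayInts (hls : ∀ k, ls k ≠ [])
    (hm : ∀ k, ExpBound 0 (m k)) {Z : ℝ × ℝ → E} (hZ : ∀ n, ExpBound n Z)
    (heq : ∀ p, Z p = ∑ k, m k p (rayInts (ls k) Z p)) (p : ℝ × ℝ) : Z p = 0 := by
  have h : ∀ j, ∀ p, picard ls m Z j p = Z p := by
    intro j
    induction j with
    | zero => exact fun p => rfl
    | succ j ih =>
      intro p
      have h1 : picard ls m Z j = Z := funext ih
      change ∑ k, m k p (rayInts (ls k) (picard ls m Z j) p) = Z p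
      rw [h1, ← heq]
  obtain ⟨C, hC⟩ := norm_picard_le hls hm hZ 0 p.1
  have h2 : Tendsto (fun j : ℕ => C * (1 / 2 : ℝ) ^ j * Real.exp (0 * p.1)) atTop (𝓝 0) := by
    have := ((tendsto_pow_atTop_nhds_zero_of_lt_one (r := (1 / 2 : ℝ)) (by norm_num)
      (by norm_num)).const_mul C).mul_const (Real.exp (0 * p.1))
    simpa using this
  refine norm_le_zero_iff.1 (ge_of_tendsto' h2 fun j => ?_)
  simpa only [h j p] using hC j p le_rfl

theorem picard_periodic {v : ℝ × ℝ} (hm : ∀ k p, m k (p + v) = m k p)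
    (hG : ∀ p, G (p + v) = G p) (j : ℕ) (p : ℝ × ℝ) :
    picard ls m G j (p + v) = picard ls m G j p := by
  induction j generalizing p with
  | zero => exact hG p
  | succ j ih => simp only [picard, hm, rayInts_periodic ih]

theorem picardSum_periodic {v : ℝ × ℝ} (hm : ∀ k p, m k (p + v) = m k p)
    (hG : ∀ p, G (p + v) = G p) (p : ℝ × ℝ) :
    picardSum ls m G (p + v) = picardSum ls m G p := by
  simp only [picardSum, picard_periodic hm hG]

end Picard

section Prolongation

variable {E : Type} [NormedAddCommGroup E] [NormedSpace ℝ E]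

/-- The part of the prolonged coefficient acting diagonally. -/
noncomputable def prolongDiag (E : Type) [NormedAddCommGroup E] [NormedSpace ℝ E] :
    (E →L[ℝ] E) →L[ℝ] (E × (ℝ × ℝ →L[ℝ] E)) →L[ℝ] E × (ℝ × ℝ →L[ℝ] E) :=
  ContinuousLinearMap.compL ℝ (E × (ℝ × ℝ →L[ℝ] E)) E (E × (ℝ × ℝ →L[ℝ] E))
      (ContinuousLinearMap.inl ℝ E (ℝ × ℝ →L[ℝ] E)) ∘L
      (ContinuousLinearMap.compL ℝ (E × (ℝ × ℝ →L[ℝ] E)) E E).flip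
        (ContinuousLinearMap.fst ℝ E (ℝ × ℝ →L[ℝ] E)) +
    ContinuousLinearMap.compL ℝ (E × (ℝ × ℝ →L[ℝ] E)) (ℝ × ℝ →L[ℝ] E)
        (E × (ℝ × ℝ →L[ℝ] E)) (ContinuousLinearMap.inr ℝ E (ℝ × ℝ →L[ℝ] E)) ∘L
      (ContinuousLinearMap.compL ℝ (E × (ℝ × ℝ →L[ℝ] E)) (ℝ × ℝ →L[ℝ] E)
        (ℝ × ℝ →L[ℝ] E)).flip (ContinuousLinearMap.snd ℝ E (ℝ × ℝ →L[ℝ] E)) ∘L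
        ContinuousLinearMap.compL ℝ (ℝ × ℝ) E E

/-- The part of the prolonged coefficient coming from the derivative of the coefficient. -/
noncomputable def prolongOff (E : Type) [NormedAddCommGroup E] [NormedSpace ℝ E] :
    (ℝ × ℝ →L[ℝ] E →L[ℝ] E) →L[ℝ] (E × (ℝ × ℝ →L[ℝ] E)) →L[ℝ] E × (ℝ × ℝ →L[ℝ] E) :=
  ContinuousLinearMap.compL ℝ (E × (ℝ × ℝ →L[ℝ] E)) (ℝ × ℝ →L[ℝ] E)
      (E × (ℝ × ℝ →L[ℝ] E)) (ContinuousLinearMap.inr ℝ E (ℝ × ℝ →L[ℝ] E)) ∘L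
    (ContinuousLinearMap.compL ℝ (E × (ℝ × ℝ →L[ℝ] E)) E (ℝ × ℝ →L[ℝ] E)).flip
        (ContinuousLinearMap.fst ℝ E (ℝ × ℝ →L[ℝ] E)) ∘L
      ((ContinuousLinearMap.flipₗᵢ ℝ (ℝ × ℝ) E E).toContinuousLinearEquiv :
        (ℝ × ℝ →L[ℝ] E →L[ℝ] E) →L[ℝ] (E →L[ℝ] ℝ × ℝ →L[ℝ] E))

/-- Coefficient of the system satisfied by a solution together with its derivative. -/
noncomputable def prolongCoeff (m : ℝ × ℝ → E →L[ℝ] E) (p : ℝ × ℝ) :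
    (E × (ℝ × ℝ →L[ℝ] E)) →L[ℝ] E × (ℝ × ℝ →L[ℝ] E) :=
  prolongDiag E (m p) + prolongOff E (fderiv ℝ m p)

theorem prolongCoeff_apply (m : ℝ × ℝ → E →L[ℝ] E) (p : ℝ × ℝ) (z : E)
    (z' : ℝ × ℝ →L[ℝ] E) : prolongCoeff m p (z, z') =
      (m p z, (m p).comp z' + (fderiv ℝ m p).flip z) := by
  simp [prolongCoeff, prolongDiag, prolongOff]

/-- A function paired with its derivative. -/
noncomputable def withFDeriv (f : ℝ × ℝ → E) (p : ℝ × ℝ) : E × (ℝ × ℝ →L[ℝ] E) :=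
  (f p, fderiv ℝ f p)

theorem ExpControl.prolongCoeff {n : ℝ} {k : ℕ} {m : ℝ × ℝ → E →L[ℝ] E}
    (hm : ExpControl n (k + 1) m) : ExpControl n k (prolongCoeff m) := by
  have h1 := hm.of_succ.clm
    (F := E × (ℝ × ℝ →L[ℝ] E) →L[ℝ] E × (ℝ × ℝ →L[ℝ] E)) (prolongDiag E)
  have h2 := hm.2.2.clm
    (F := E × (ℝ × ℝ →L[ℝ] E) →L[ℝ] E × (ℝ × ℝ →L[ℝ] E)) (prolongOff E)
  exact h1.add h2

theorem ExpControl.withFDeriv {n : ℝ} {k : ℕ} {f : ℝ × ℝ → E}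
    (hf : ExpControl n (k + 1) f) : ExpControl n k (withFDeriv f) := by
  have := (hf.of_succ.clm (ContinuousLinearMap.inl ℝ E (ℝ × ℝ →L[ℝ] E))).add
    (hf.2.2.clm (ContinuousLinearMap.inr ℝ E (ℝ × ℝ →L[ℝ] E)))
  refine cast ?_ this
  congr 1
  ext1 p
  simp [Misner.withFDeriv]

variable {ι : Type} [Fintype ι] {ls : ι → List ℝ} {m : ι → ℝ × ℝ → E →L[ℝ] E}
  {G : ℝ × ℝ → E}

theorem picard_prolong [CompleteSpace E] (hm : ∀ k, ExpControl 0 1 (m k))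
    (hG : ∀ n, ExpControl n 1 G) (j : ℕ) :
    Differentiable ℝ (picard ls m G j) ∧
      picard ls (fun k => prolongCoeff (m k)) (withFDeriv G) j =
        withFDeriv (picard ls m G j) := by
  have hp : ∀ j, ExpControl 1 0 (picard ls (fun k => prolongCoeff (m k)) (withFDeriv G) j) :=
    fun j => ExpControl.picard zero_lt_one (fun k => (hm k).prolongCoeff) (hG 1).withFDeriv j
  induction j with
  | zero => exact ⟨(hG 0).1, rfl⟩
  | succ j ih =>
    obtain ⟨ih1, ih2⟩ := ih
    have hj := hp j
    rw [ih2] at hj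
    have hf : ExpControl 1 1 (picard ls m G j) :=
      ⟨ih1, (hj.clm (ContinuousLinearMap.fst ℝ E (ℝ × ℝ →L[ℝ] E))).2,
        hj.clm (ContinuousLinearMap.snd ℝ E (ℝ × ℝ →L[ℝ] E))⟩
    have hd : ∀ k p, HasFDerivAt (fun p => m k p (rayInts (ls k) (picard ls m G j) p))
        ((m k p).comp (rayInts (ls k) (fderiv ℝ (picard ls m G j)) p) +
          (fderiv ℝ (m k) p).flip (rayInts (ls k) (picard ls m G j) p)) p :=
      fun k p => ((hm k).1 p).hasFDerivAt.clm_apply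
        (hasFDerivAt_rayInts zero_lt_one hf (ls k) p)
    have hs : ∀ p, HasFDerivAt (picard ls m G (j + 1))
        (∑ k, ((m k p).comp (rayInts (ls k) (fderiv ℝ (picard ls m G j)) p) +
          (fderiv ℝ (m k) p).flip (rayInts (ls k) (picard ls m G j) p))) p :=
      fun p => HasFDerivAt.fun_sum fun k _ => hd k p
    refine ⟨fun p => (hs p).differentiableAt, ?_⟩
    ext1 p
    have hr : ∀ k, rayInts (ls k) (withFDeriv (picard ls m G j)) p =
        (rayInts (ls k) (picard ls m G j) p,
          rayInts (ls k) (fderiv ℝ (picard ls m G j)) p) := by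
      intro k
      refine Prod.ext ?_ ?_
      · exact (clm_rayInts zero_lt_one hj
          (ContinuousLinearMap.fst ℝ E (ℝ × ℝ →L[ℝ] E)) (ls k) p).symm
      · exact (clm_rayInts zero_lt_one hj
          (ContinuousLinearMap.snd ℝ E (ℝ × ℝ →L[ℝ] E)) (ls k) p).symm
    rw [withFDeriv, (hs p).fderiv]
    simp only [picard, ih2, hr, prolongCoeff_apply]
    exact Prod.ext (by simp [Prod.fst_sum]) (by simp [Prod.snd_sum])

theorem picardSum_flat [CompleteSpace E] (hls : ∀ k, ls k ≠ []) (d : ℕ)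
    (hm : ∀ k, ExpControl 0 d (m k)) (hG : ∀ n, ExpControl n d G) (n : ℝ) :
    ExpControl n d (picardSum ls m G) := by
  induction d generalizing E n with
  | zero => exact picardSum_flat_zero hls hm hG n
  | succ d ih =>
    have hm1 : ∀ k, ExpControl 0 1 (m k) := fun k => ⟨(hm k).1, (hm k).2.1, (hm k).2.2.zero⟩
    have hG1 : ∀ n, ExpControl n 1 G := fun n => ⟨(hG n).1, (hG n).2.1, (hG n).2.2.zero⟩
    have hpro := picard_prolong (ls := ls) hm1 hG1
    have hS := ih (fun k => (hm k).prolongCoeff) (fun n => (hG n).withFDeriv)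
    have hb := norm_picard_le hls (fun k => (hm k).prolongCoeff.expBound)
      (fun n => (hG n).withFDeriv.expBound) 1
    have hsum := summable_of_geometric hb
    have hfst : ∀ p, HasSum (fun j => picard ls m G j p) (picardSum ls
        (fun k => prolongCoeff (m k)) (withFDeriv G) p).1 := by
      intro p
      have := (ContinuousLinearMap.fst ℝ E (ℝ × ℝ →L[ℝ] E)).hasSum (hsum p).hasSum
      refine this.congr_fun ?_
      intro j
      rw [(hpro j).2]
      rfl
    have hsnd : ∀ p, HasSum (fun j => fderiv ℝ (picard ls m G j) p) (picardSum ls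
        (fun k => prolongCoeff (m k)) (withFDeriv G) p).2 := by
      intro p
      have := (ContinuousLinearMap.snd ℝ E (ℝ × ℝ →L[ℝ] E)).hasSum (hsum p).hasSum
      refine this.congr_fun ?_
      intro j
      rw [(hpro j).2]
      rfl
    have hd : ∀ p, HasFDerivAt (picardSum ls m G) (picardSum ls
        (fun k => prolongCoeff (m k)) (withFDeriv G) p).2 p := by
      intro p
      obtain ⟨C, hC⟩ := hb (p.1 + 1)
      have h0 : 0 ≤ C := nonneg_of_mul_nonneg_left
        (by simpa using (norm_nonneg _).trans (hC 0 (p.1 + 1, 0) le_rfl)) (Real.exp_pos _)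
      have hp : p ∈ {q : ℝ × ℝ | q.1 < p.1 + 1} := mem_of_mem_nhds (halfPlane_mem_nhds p)
      rw [← (hsnd p).tsum_eq]
      refine hasFDerivAt_tsum_of_isPreconnected (s := {q : ℝ × ℝ | q.1 < p.1 + 1})
        ((summable_geometric_two.mul_left C).mul_right (Real.exp (1 * (p.1 + 1))))
        (isOpen_lt continuous_fst continuous_const) ?_
        (fun j q _ => ((hpro j).1 q).hasFDerivAt) ?_ hp (hfst p).summable hp
      · exact (convex_halfSpace_lt (f := Prod.fst)
          (ContinuousLinearMap.fst ℝ ℝ ℝ).isBoundedLinearMap.toIsLinearMap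
          (p.1 + 1)).isPreconnected
      · intro j q hq
        have hq' : q.1 < p.1 + 1 := hq
        have h1 := hC j q hq'.le
        rw [(hpro j).2] at h1
        refine ((norm_snd_le _).trans h1).trans ?_
        gcongr
    have hd' : fderiv ℝ (picardSum ls m G) = fun p => ContinuousLinearMap.snd ℝ E
        (ℝ × ℝ →L[ℝ] E) (picardSum ls (fun k => prolongCoeff (m k)) (withFDeriv G) p) :=
      funext fun p => (hd p).fderiv
    refine ⟨fun p => (hd p).differentiableAt, ?_, ?_⟩
    · exact (picardSum_flat_zero hls (fun k => (hm k).zero) (fun n => (hG n).zero) n).2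
    · rw [hd']
      exact (hS n).clm _

end Prolongation

section Calculus

variable {u v : ℝ → ℝ → ℝ}

theorem Smooth2.hasFDerivAt_uncurry (hu : Smooth2 u) (p : ℝ × ℝ) :
    HasFDerivAt (fun q : ℝ × ℝ => u q.1 q.2) (fderiv ℝ (fun q : ℝ × ℝ => u q.1 q.2) p) p :=
  (ContDiff.differentiable hu (by simp) p).hasFDerivAt

theorem Smooth2.hasDerivAt_fst (hu : Smooth2 u) (t x : ℝ) :
    HasDerivAt (fun s => u s x) (fderiv ℝ (fun q : ℝ × ℝ => u q.1 q.2) (t, x) (1, 0)) t :=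
  (Smooth2.hasFDerivAt_uncurry hu (t, x)).comp_hasDerivAt (f := fun s => (s, x)) t
    ((hasDerivAt_id t).prodMk (hasDerivAt_const t x))

theorem Smooth2.hasDerivAt_snd (hu : Smooth2 u) (t x : ℝ) :
    HasDerivAt (fun y => u t y) (fderiv ℝ (fun q : ℝ × ℝ => u q.1 q.2) (t, x) (0, 1)) x :=
  (Smooth2.hasFDerivAt_uncurry hu (t, x)).comp_hasDerivAt (f := fun y => (t, y)) x
    ((hasDerivAt_const x t).prodMk (hasDerivAt_id x))

theorem pt_eq_fderiv (hu : Smooth2 u) (t x : ℝ) :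
    pt u t x = fderiv ℝ (fun q : ℝ × ℝ => u q.1 q.2) (t, x) (1, 0) :=
  (Smooth2.hasDerivAt_fst hu t x).deriv

theorem px_eq_fderiv (hu : Smooth2 u) (t x : ℝ) :
    px u t x = fderiv ℝ (fun q : ℝ × ℝ => u q.1 q.2) (t, x) (0, 1) :=
  (Smooth2.hasDerivAt_snd hu t x).deriv

theorem hasDerivAt_pt (hu : Smooth2 u) (t x : ℝ) :
    HasDerivAt (fun s => u s x) (pt u t x) t :=
  (Smooth2.hasDerivAt_fst hu t x).differentiableAt.hasDerivAt

theorem hasDerivAt_px (hu : Smooth2 u) (t x : ℝ) :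
    HasDerivAt (fun y => u t y) (px u t x) x :=
  (Smooth2.hasDerivAt_snd hu t x).differentiableAt.hasDerivAt

theorem hasFDerivAt_pt_px (hu : Smooth2 u) (p : ℝ × ℝ) :
    HasFDerivAt (fun q : ℝ × ℝ => u q.1 q.2)
      (pt u p.1 p.2 • ContinuousLinearMap.fst ℝ ℝ ℝ +
        px u p.1 p.2 • ContinuousLinearMap.snd ℝ ℝ ℝ) p := by
  refine (Smooth2.hasFDerivAt_uncurry hu p).congr_fderiv ?_
  rw [pt_eq_fderiv hu, px_eq_fderiv hu]
  ext <;> simp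

theorem smooth2_fderiv_apply (hu : Smooth2 u) (v : ℝ × ℝ) :
    ContDiff ℝ (⊤ : ℕ∞) fun p => fderiv ℝ (fun q : ℝ × ℝ => u q.1 q.2) p v :=
  (ContDiff.fderiv_right (m := (⊤ : ℕ∞)) hu (by simp)).clm_apply contDiff_const

theorem smooth2_pt (hu : Smooth2 u) : Smooth2 (pt u) := by
  have : (fun p : ℝ × ℝ => pt u p.1 p.2) =
      fun p => fderiv ℝ (fun q : ℝ × ℝ => u q.1 q.2) p (1, 0) :=
    funext fun p => pt_eq_fderiv hu p.1 p.2
  rw [Smooth2, this]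
  exact smooth2_fderiv_apply hu _

theorem smooth2_px (hu : Smooth2 u) : Smooth2 (px u) := by
  have : (fun p : ℝ × ℝ => px u p.1 p.2) =
      fun p => fderiv ℝ (fun q : ℝ × ℝ => u q.1 q.2) p (0, 1) :=
    funext fun p => px_eq_fderiv hu p.1 p.2
  rw [Smooth2, this]
  exact smooth2_fderiv_apply hu _

theorem smooth2_iterate_pt (hu : Smooth2 u) (k : ℕ) : Smooth2 (pt^[k] u) := by
  induction k with
  | zero => exact hu
  | succ k ih =>
    rw [Function.iterate_succ_apply']
    exact smooth2_pt ih

theorem smooth2_add (hu : Smooth2 u) (hv : Smooth2 v) :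
    Smooth2 (fun t x => u t x + v t x) := ContDiff.add hu hv

theorem smooth2_sub (hu : Smooth2 u) (hv : Smooth2 v) :
    Smooth2 (fun t x => u t x - v t x) := ContDiff.sub hu hv

theorem smooth2_mul (hu : Smooth2 u) (hv : Smooth2 v) :
    Smooth2 (fun t x => u t x * v t x) := ContDiff.mul hu hv

theorem smooth2_time : Smooth2 (fun t _ => t) := contDiff_fst

theorem smooth2_const (c : ℝ) : Smooth2 (fun _ _ => c) := contDiff_const

theorem pt_add (hu : Smooth2 u) (hv : Smooth2 v) :
    pt (fun t x => u t x + v t x) = fun t x => pt u t x + pt v t x := by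
  ext t x
  exact ((hasDerivAt_pt hu t x).add (hasDerivAt_pt hv t x)).deriv

theorem pt_sub (hu : Smooth2 u) (hv : Smooth2 v) :
    pt (fun t x => u t x - v t x) = fun t x => pt u t x - pt v t x := by
  ext t x
  exact ((hasDerivAt_pt hu t x).sub (hasDerivAt_pt hv t x)).deriv

theorem px_sub (hu : Smooth2 u) (hv : Smooth2 v) :
    px (fun t x => u t x - v t x) = fun t x => px u t x - px v t x := by
  ext t x
  exact ((hasDerivAt_px hu t x).sub (hasDerivAt_px hv t x)).deriv

theorem pt_mul (hu : Smooth2 u) (hv : Smooth2 v) :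
    pt (fun t x => u t x * v t x) = fun t x => pt u t x * v t x + u t x * pt v t x := by
  ext t x
  exact ((hasDerivAt_pt hu t x).mul (hasDerivAt_pt hv t x)).deriv

theorem pt_time_mul (hu : Smooth2 u) :
    pt (fun t x => t * u t x) = fun t x => u t x + t * pt u t x := by
  ext t x
  refine (((hasDerivAt_id t).mul (hasDerivAt_pt hu t x)).congr_deriv ?_).deriv
  rw [one_mul, id]

theorem pt_px_comm (hu : Smooth2 u) : pt (px u) = px (pt u) := by
  ext t x
  have hd : Differentiable ℝ (fderiv ℝ (fun q : ℝ × ℝ => u q.1 q.2)) :=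
    (ContDiff.fderiv_right (m := (⊤ : ℕ∞)) hu (by simp)).differentiable (by simp)
  have hv : ∀ v : ℝ × ℝ, HasFDerivAt (fun p => fderiv ℝ (fun q : ℝ × ℝ => u q.1 q.2) p v)
      ((fderiv ℝ (fderiv ℝ (fun q : ℝ × ℝ => u q.1 q.2)) (t, x)).flip v) (t, x) := by
    intro v
    simpa using (hd (t, x)).hasFDerivAt.clm_apply (hasFDerivAt_const v (t, x))
  have h1 : px u = fun t x => fderiv ℝ (fun q : ℝ × ℝ => u q.1 q.2) (t, x) (0, 1) := by
    ext t x
    exact px_eq_fderiv hu t x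
  have h2 : pt u = fun t x => fderiv ℝ (fun q : ℝ × ℝ => u q.1 q.2) (t, x) (1, 0) := by
    ext t x
    exact pt_eq_fderiv hu t x
  rw [pt_eq_fderiv (smooth2_px hu), px_eq_fderiv (smooth2_pt hu), h1, h2]
  have e1 := (hv (0, 1)).fderiv
  have e2 := (hv (1, 0)).fderiv
  simp only [Prod.mk.eta]
  rw [e1, e2]
  exact second_derivative_symmetric (f := fun q : ℝ × ℝ => u q.1 q.2)
    (fun y => Smooth2.hasFDerivAt_uncurry hu y) (hd (t, x)).hasFDerivAt (1, 0) (0, 1)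

theorem periodic2_pt (hu : Periodic2 u) : Periodic2 (pt u) := by
  intro t x
  exact congrArg (fun g : ℝ → ℝ => deriv g t) (funext fun s => hu s x)

theorem periodic2_px (hu : Periodic2 u) : Periodic2 (px u) := by
  intro t x
  have h : (fun y => u t y) = fun y => u t (y + 2 * Real.pi) := funext fun y => (hu t y).symm
  change deriv (fun y => u t y) (x + 2 * Real.pi) = deriv (fun y => u t y) x
  conv_rhs => rw [h]
  rw [deriv_comp_add_const]

theorem periodic2_add (hu : Periodic2 u) (hv : Periodic2 v) :
    Periodic2 (fun t x => u t x + v t x) := fun t x => by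
  simp only [hu t x, hv t x]

theorem periodic2_sub (hu : Periodic2 u) (hv : Periodic2 v) :
    Periodic2 (fun t x => u t x - v t x) := fun t x => by
  simp only [hu t x, hv t x]

theorem periodic2_mul (hu : Periodic2 u) (hv : Periodic2 v) :
    Periodic2 (fun t x => u t x * v t x) := fun t x => by
  simp only [hu t x, hv t x]

theorem iterate_pt_sub (hu : Smooth2 u) (hv : Smooth2 v) (k : ℕ) (t x : ℝ) :
    pt^[k] (fun t x => u t x - v t x) t x = pt^[k] u t x - pt^[k] v t x := by
  have h : pt^[k] (fun t x => u t x - v t x) = fun t x => pt^[k] u t x - pt^[k] v t x := by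
    induction k with
    | zero => rfl
    | succ k ih =>
      simp only [Function.iterate_succ_apply', ih]
      exact pt_sub (smooth2_iterate_pt hu k) (smooth2_iterate_pt hv k)
  exact congrFun₂ h t x

theorem iterate_pt_add (hu : Smooth2 u) (hv : Smooth2 v) (k : ℕ) (t x : ℝ) :
    pt^[k] (fun t x => u t x + v t x) t x = pt^[k] u t x + pt^[k] v t x := by
  have h : pt^[k] (fun t x => u t x + v t x) = fun t x => pt^[k] u t x + pt^[k] v t x := by
    induction k with
    | zero => rfl
    | succ k ih =>
      simp only [Function.iterate_succ_apply', ih]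
      exact pt_add (smooth2_iterate_pt hu k) (smooth2_iterate_pt hv k)
  exact congrFun₂ h t x

theorem periodic2_iterate_pt (hu : Periodic2 u) (k : ℕ) : Periodic2 (pt^[k] u) := by
  induction k with
  | zero => exact hu
  | succ k ih =>
    rw [Function.iterate_succ_apply']
    exact periodic2_pt ih

theorem iterate_pt_eq_iteratedDeriv (u : ℝ → ℝ → ℝ) (k : ℕ) (t x : ℝ) :
    pt^[k] u t x = iteratedDeriv k (fun s => u s x) t := by
  induction k generalizing t with
  | zero => simp
  | succ k ih =>
    rw [Function.iterate_succ_apply', iteratedDeriv_succ]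
    exact congrArg (fun g : ℝ → ℝ => deriv g t) (funext ih)

end Calculus

section Vanishing

variable {u v : ℝ → ℝ → ℝ}

/-- Smooth periodic functions whose time derivatives of order `< n` vanish at `t = 0`. -/
def VanishesTo : ℕ → (ℝ → ℝ → ℝ) → Prop
  | 0, u => Smooth2 u ∧ Periodic2 u
  | n + 1, u => Smooth2 u ∧ Periodic2 u ∧ (∀ x, u 0 x = 0) ∧ VanishesTo n (pt u)

theorem VanishesTo.smooth {n : ℕ} (h : VanishesTo n u) : Smooth2 u := by
  cases n <;> exact h.1

theorem VanishesTo.periodic {n : ℕ} (h : VanishesTo n u) : Periodic2 u := by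
  cases n
  exacts [h.2, h.2.1]

theorem vanishesTo_iff {n : ℕ} : VanishesTo n u ↔
    Smooth2 u ∧ Periodic2 u ∧ ∀ k < n, ∀ x, pt^[k] u 0 x = 0 := by
  induction n generalizing u with
  | zero => simp [VanishesTo]
  | succ n ih =>
    simp only [VanishesTo, ih]
    constructor
    · rintro ⟨h1, h2, h3, -, -, h4⟩
      refine ⟨h1, h2, fun k hk => ?_⟩
      cases k with
      | zero => exact h3
      | succ k => exact h4 k (by omega)
    · rintro ⟨h1, h2, h3⟩
      exact ⟨h1, h2, h3 0 (by omega), smooth2_pt h1, periodic2_pt h2,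
        fun k hk => h3 (k + 1) (by omega)⟩

theorem VanishesTo.of_succ {n : ℕ} (h : VanishesTo (n + 1) u) : VanishesTo n u := by
  rw [vanishesTo_iff] at *
  exact ⟨h.1, h.2.1, fun k hk => h.2.2 k (by omega)⟩

theorem VanishesTo.pt {n : ℕ} (h : VanishesTo (n + 1) u) : VanishesTo n (pt u) := h.2.2.2

theorem VanishesTo.sub {n : ℕ} (hu : VanishesTo n u) (hv : VanishesTo n v) :
    VanishesTo n (fun t x => u t x - v t x) := by
  rw [vanishesTo_iff] at *
  refine ⟨smooth2_sub hu.1 hv.1, periodic2_sub hu.2.1 hv.2.1, fun k hk x => ?_⟩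
  rw [iterate_pt_sub hu.1 hv.1, hu.2.2 k hk, hv.2.2 k hk, sub_zero]

theorem VanishesTo.add {n : ℕ} (hu : VanishesTo n u) (hv : VanishesTo n v) :
    VanishesTo n (fun t x => u t x + v t x) := by
  rw [vanishesTo_iff] at *
  refine ⟨smooth2_add hu.1 hv.1, periodic2_add hu.2.1 hv.2.1, fun k hk x => ?_⟩
  rw [iterate_pt_add hu.1 hv.1, hu.2.2 k hk, hv.2.2 k hk, add_zero]

theorem VanishesTo.mul {n : ℕ} {m : ℝ → ℝ → ℝ} (hm : VanishesTo 0 m)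
    (hu : VanishesTo n u) : VanishesTo n (fun t x => m t x * u t x) := by
  induction n generalizing u m with
  | zero => exact ⟨smooth2_mul hm.1 hu.1, periodic2_mul hm.2 hu.2⟩
  | succ n ih =>
    refine ⟨smooth2_mul hm.1 hu.1, periodic2_mul hm.2 hu.2.1,
      fun x => by simp only [hu.2.2.1, mul_zero], ?_⟩
    rw [pt_mul hm.1 hu.1]
    exact (ih ⟨smooth2_pt hm.1, periodic2_pt hm.2⟩ hu.of_succ).add (ih hm hu.pt)

theorem vanishesTo_time : VanishesTo 0 (fun t _ => t) := ⟨smooth2_time, fun _ _ => rfl⟩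

theorem vanishesTo_const (c : ℝ) : VanishesTo 0 (fun _ _ => c) :=
  ⟨smooth2_const c, fun _ _ => rfl⟩

theorem VanishesTo.time_mul {n : ℕ} (hu : VanishesTo n u) :
    VanishesTo (n + 1) (fun t x => t * u t x) := by
  induction n generalizing u with
  | zero =>
    refine ⟨smooth2_mul smooth2_time hu.1, periodic2_mul vanishesTo_time.2 hu.2,
      fun x => zero_mul _, ?_⟩
    rw [pt_time_mul hu.1]
    exact hu.add (vanishesTo_time.mul (u := _root_.pt u) ⟨smooth2_pt hu.1, periodic2_pt hu.2⟩)
  | succ n ih =>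
    refine ⟨smooth2_mul smooth2_time hu.1, periodic2_mul vanishesTo_time.2 hu.2.1,
      fun x => zero_mul _, ?_⟩
    rw [pt_time_mul hu.1]
    exact hu.add (ih hu.pt)

theorem VanishesTo.px {n : ℕ} (hu : VanishesTo n u) : VanishesTo n (px u) := by
  induction n generalizing u with
  | zero => exact ⟨smooth2_px hu.1, periodic2_px hu.2⟩
  | succ n ih =>
    refine ⟨smooth2_px hu.1, periodic2_px hu.2.1, fun x => ?_, ?_⟩
    · simp [_root_.px, hu.2.2.1]
    · rw [pt_px_comm hu.1]
      exact ih hu.pt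

theorem VanishesTo.misnerP {n : ℕ} {a b c : ℝ → ℝ → ℝ} (ha : VanishesTo 0 a)
    (hb : VanishesTo 0 b) (hc : VanishesTo 0 c) (hu : VanishesTo n u)
    (hu1 : VanishesTo n (_root_.pt u)) (hu2 : VanishesTo n (_root_.pt (_root_.pt u))) :
    VanishesTo n (MisnerP a b c u) :=
  (((((vanishesTo_time.mul hu2).sub ((vanishesTo_const 2).mul hu1.px)).add hu1).add
    (ha.mul hu.px)).add (hb.mul hu1)).add (hc.mul hu)

theorem misnerP_sub {a b c : ℝ → ℝ → ℝ} (hu : Smooth2 u) (hv : Smooth2 v) (t x : ℝ) :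
    MisnerP a b c (fun t x => u t x - v t x) t x = MisnerP a b c u t x - MisnerP a b c v t x := by
  simp only [MisnerP, pt_sub hu hv, px_sub hu hv, pt_sub (smooth2_pt hu) (smooth2_pt hv),
    px_sub (smooth2_pt hu) (smooth2_pt hv)]
  ring

theorem VanishesTo.time_mul_pt {n : ℕ} (hu : VanishesTo n u) :
    VanishesTo n (fun t x => t * _root_.pt u t x) := by
  cases n with
  | zero => exact vanishesTo_time.mul ⟨smooth2_pt hu.1, periodic2_pt hu.2⟩
  | succ n => exact hu.pt.time_mul

theorem exists_bound_of_periodic (hu : Continuous fun p : ℝ × ℝ => u p.1 p.2)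
    (hp : Periodic2 u) (T : ℝ) : ∃ C : ℝ, ∀ t x : ℝ, |t| ≤ T → ‖u t x‖ ≤ C := by
  obtain ⟨C, hC⟩ := (isCompact_Icc.prod isCompact_Icc :
    IsCompact (Icc (-T) T ×ˢ Icc (0 : ℝ) (2 * Real.pi))).exists_bound_of_continuousOn
      hu.continuousOn
  refine ⟨C, fun t x ht => ?_⟩
  have hper : Function.Periodic (fun y => u t y) (2 * Real.pi) := hp t
  obtain ⟨y, hy, hxy⟩ := hper.exists_mem_Ico₀ Real.two_pi_pos x
  rw [hxy]
  exact hC (t, y) ⟨abs_le.1 ht, hy.1, hy.2.le⟩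

theorem VanishesTo.norm_le {n : ℕ} (hu : VanishesTo n u) (T : ℝ) :
    ∃ C : ℝ, ∀ t x : ℝ, 0 ≤ t → t ≤ T → ‖u t x‖ ≤ C * t ^ n := by
  induction n generalizing u with
  | zero =>
    obtain ⟨C, hC⟩ := exists_bound_of_periodic (ContDiff.continuous hu.1) hu.2 T
    refine ⟨C, fun t x h0 hT => ?_⟩
    simpa using hC t x (by rwa [abs_of_nonneg h0])
  | succ n ih =>
    obtain ⟨C, hC⟩ := ih hu.pt
    refine ⟨C, fun t x h0 hT => ?_⟩
    have h := (convex_Icc (0 : ℝ) t).norm_image_sub_le_of_norm_hasDerivWithin_le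
      (f := fun s => u s x) (C := C * t ^ n)
      (fun s _ => (hasDerivAt_pt hu.1 s x).hasDerivWithinAt)
      (fun s hs => ?_) (left_mem_Icc.2 h0) (right_mem_Icc.2 h0)
    · simpa [hu.2.2.1, abs_of_nonneg h0, pow_succ, mul_assoc] using h
    · have h1 := hC s x hs.1 (hs.2.trans hT)
      have hC0 : 0 ≤ C ∨ T ≤ 0 := by
        by_contra! hcon
        have h2 := (norm_nonneg _).trans (hC T x hcon.2.le le_rfl)
        have := mul_neg_of_neg_of_pos hcon.1 (pow_pos hcon.2 n)
        linarith
      rcases hC0 with hC0 | hT0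
      · refine h1.trans ?_
        gcongr
        exacts [hs.1, hs.2]
      · have : s = t := by linarith [hs.1, hs.2]
        rwa [← this]

/-- Pull back along `t = exp s`. -/
noncomputable def expPull (u : ℝ → ℝ → ℝ) (p : ℝ × ℝ) : ℝ := u (Real.exp p.1) p.2

theorem hasFDerivAt_expPull (hu : Smooth2 u) (p : ℝ × ℝ) :
    HasFDerivAt (expPull u)
      (expPull (fun t x => t * pt u t x) p • ContinuousLinearMap.fst ℝ ℝ ℝ +
        expPull (px u) p • ContinuousLinearMap.snd ℝ ℝ ℝ) p := by
  have h1 : HasFDerivAt (fun q : ℝ × ℝ => (Real.exp q.1, q.2))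
      ((Real.exp p.1 • ContinuousLinearMap.fst ℝ ℝ ℝ).prod (ContinuousLinearMap.snd ℝ ℝ ℝ)) p :=
    (hasFDerivAt_fst.exp).prodMk hasFDerivAt_snd
  refine ((hasFDerivAt_pt_px hu (Real.exp p.1, p.2)).comp p h1).congr_fderiv ?_
  ext <;> simp [expPull, mul_comm]

theorem VanishesTo.expControl {n : ℕ} (hu : VanishesTo n u) (k : ℕ) :
    ExpControl n k (expPull u) := by
  have hb : ∀ {u : ℝ → ℝ → ℝ}, VanishesTo n u → ExpBound n (expPull u) := by
    intro u hu S
    obtain ⟨C, hC⟩ := hu.norm_le (Real.exp S)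
    refine ⟨C, fun p hp => ?_⟩
    rw [Real.exp_nat_mul]
    exact hC _ _ (Real.exp_pos _).le (Real.exp_le_exp.2 hp)
  have hd : ∀ {u : ℝ → ℝ → ℝ}, VanishesTo n u → Differentiable ℝ (expPull u) :=
    fun hu p => (hasFDerivAt_expPull hu.smooth p).differentiableAt
  induction k generalizing u with
  | zero => exact ⟨(hd hu).continuous, hb hu⟩
  | succ k ih =>
    refine ⟨hd hu, hb hu, ?_⟩
    have : fderiv ℝ (expPull u) = fun p =>
        ContinuousLinearMap.toSpanSingleton ℝ (ContinuousLinearMap.fst ℝ ℝ ℝ)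
          (expPull (fun t x => t * _root_.pt u t x) p) +
        ContinuousLinearMap.toSpanSingleton ℝ (ContinuousLinearMap.snd ℝ ℝ ℝ)
          (expPull (_root_.px u) p) :=
      funext fun p => (hasFDerivAt_expPull hu.smooth p).fderiv
    rw [this]
    exact ((ih hu.time_mul_pt).clm _).add ((ih hu.px).clm _)

end Vanishing

section Extension

variable {E : Type} [NormedAddCommGroup E] [NormedSpace ℝ E]

theorem ExpBound.exp_neg_smul {f : ℝ × ℝ → E} {n : ℝ} (hf : ExpBound (n + 1) f) :
    ExpBound n (fun p => Real.exp (-p.1) • f p) := by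
  intro S
  obtain ⟨C, hC⟩ := hf S
  refine ⟨C, fun p hp => ?_⟩
  rw [norm_smul, Real.norm_eq_abs, Real.abs_exp]
  calc Real.exp (-p.1) * ‖f p‖ ≤ Real.exp (-p.1) * (C * Real.exp ((n + 1) * p.1)) := by
        gcongr
        exact hC p hp
    _ = C * Real.exp (n * p.1) := by
        rw [mul_left_comm, ← Real.exp_add]
        ring_nf

theorem ExpControl.exp_neg_smul {f : ℝ × ℝ → E} {k : ℕ} (hf : ∀ n, ExpControl n k f) (n : ℝ) :
    ExpControl n k (fun p => Real.exp (-p.1) • f p) := by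
  induction k generalizing E n with
  | zero =>
    exact ⟨(Real.continuous_exp.comp continuous_fst.neg).smul (hf 0).1, (hf (n + 1)).2.exp_neg_smul⟩
  | succ k ih =>
    have hd : ∀ p : ℝ × ℝ, HasFDerivAt (fun p => Real.exp (-p.1) • f p)
        (Real.exp (-p.1) • fderiv ℝ f p + (-ContinuousLinearMap.smulRightL ℝ (ℝ × ℝ) E
          (ContinuousLinearMap.fst ℝ ℝ ℝ)) (Real.exp (-p.1) • f p)) p := by
      intro p
      have h1 : HasFDerivAt (fun q : ℝ × ℝ => Real.exp (-q.1))
          (Real.exp (-p.1) • -ContinuousLinearMap.fst ℝ ℝ ℝ) p := hasFDerivAt_fst.neg.exp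
      refine (h1.smul ((hf 0).1 p).hasFDerivAt).congr_fderiv ?_
      ext <;> simp
    refine ⟨fun p => (hd p).differentiableAt, (hf (n + 1)).2.1.exp_neg_smul, ?_⟩
    rw [show fderiv ℝ (fun p => Real.exp (-p.1) • f p) = _ from funext fun p => (hd p).fderiv]
    exact (ih (fun n => (hf n).2.2) n).add
      ((ih (fun n => (hf n).of_succ) n).clm (F := ℝ × ℝ →L[ℝ] E) _)

/-- Transport a function of `(log t, x)` to the half-plane `{t > 0}`, extended by zero. -/
noncomputable def logPull (F : ℝ × ℝ → E) (p : ℝ × ℝ) : E :=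
  if 0 < p.1 then F (Real.log p.1, p.2) else 0

/-- The derivative of `F (log t, x)` in terms of the logarithmic variables. -/
noncomputable def logFDeriv (F : ℝ × ℝ → E) (p : ℝ × ℝ) : ℝ × ℝ →L[ℝ] E :=
  (ContinuousLinearMap.compL ℝ (ℝ × ℝ) (ℝ × ℝ) E).flip
      ((ContinuousLinearMap.inl ℝ ℝ ℝ).comp (ContinuousLinearMap.fst ℝ ℝ ℝ))
      (Real.exp (-p.1) • fderiv ℝ F p) +
    (ContinuousLinearMap.compL ℝ (ℝ × ℝ) (ℝ × ℝ) E).flip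
      ((ContinuousLinearMap.inr ℝ ℝ ℝ).comp (ContinuousLinearMap.snd ℝ ℝ ℝ)) (fderiv ℝ F p)

theorem ExpControl.logFDeriv {F : ℝ × ℝ → E} {k : ℕ} (hF : ∀ n, ExpControl n (k + 1) F) (n : ℝ) :
    ExpControl n k (logFDeriv F) :=
  ((ExpControl.exp_neg_smul (fun n => (hF n).2.2) n).clm (F := ℝ × ℝ →L[ℝ] E) _).add
    ((hF n).2.2.clm (F := ℝ × ℝ →L[ℝ] E) _)

theorem hasFDerivAt_logPull {F : ℝ × ℝ → E} (hd : Differentiable ℝ F) (hb : ∀ n, ExpBound n F)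
    (p : ℝ × ℝ) : HasFDerivAt (logPull F) (logPull (logFDeriv F) p) p := by
  rcases lt_trichotomy 0 p.1 with hp | hp | hp
  · have hev : logPull F =ᶠ[𝓝 p] fun q : ℝ × ℝ => F (Real.log q.1, q.2) := by
      filter_upwards [continuous_fst.continuousAt.eventually (lt_mem_nhds hp)] with q hq
      exact if_pos hq
    rw [logPull, if_pos hp]
    have h1 : HasFDerivAt (fun q : ℝ × ℝ => (Real.log q.1, q.2))
        ((p.1⁻¹ • ContinuousLinearMap.fst ℝ ℝ ℝ).prod (ContinuousLinearMap.snd ℝ ℝ ℝ)) p :=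
      (hasFDerivAt_fst.log hp.ne').prodMk hasFDerivAt_snd
    refine (((hd (Real.log p.1, p.2)).hasFDerivAt.comp p h1).congr_fderiv ?_).congr_of_eventuallyEq
      hev
    ext
    · simp [logFDeriv, Real.exp_neg, Real.exp_log hp, ← map_smul]
      exact map_zero _
    · simp [logFDeriv]
      exact map_zero _
  · rw [logPull, if_neg hp.not_lt]
    obtain ⟨C, hC⟩ := hb 2 0
    refine Asymptotics.IsBigO.hasFDerivAt (n := 2) ?_ one_lt_two
    have h0 : logPull F p = 0 := if_neg hp.not_lt
    refine Asymptotics.IsBigO.of_bound C ?_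
    filter_upwards [continuous_fst.continuousAt.eventually
      (gt_mem_nhds (show p.1 < 1 by rw [← hp]; exact one_pos))] with q hq
    have hC0 : 0 ≤ C := nonneg_of_mul_nonneg_left
      ((norm_nonneg _).trans (hC (0, 0) le_rfl)) (Real.exp_pos _)
    rw [Real.norm_of_nonneg (by positivity)]
    by_cases hq0 : 0 < q.1
    · rw [logPull, if_pos hq0]
      refine (hC _ (Real.log_nonpos hq0.le hq.le)).trans ?_
      have h1 : Real.exp (2 * Real.log q.1) = q.1 ^ 2 := by
        rw [two_mul, Real.exp_add, Real.exp_log hq0, sq]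
      have h2 : q.1 ≤ ‖q - p‖ := by
        have := norm_fst_le (q - p)
        rwa [Prod.fst_sub, ← hp, sub_zero, Real.norm_of_nonneg hq0.le] at this
      rw [h1]
      gcongr
    · rw [logPull, if_neg hq0, norm_zero]
      positivity
  · have hev : logPull F =ᶠ[𝓝 p] fun _ => (0 : E) := by
      filter_upwards [continuous_fst.continuousAt.eventually (gt_mem_nhds hp)] with q hq
      exact if_neg hq.not_gt
    rw [logPull, if_neg hp.not_gt]
    exact (hasFDerivAt_const 0 p).congr_of_eventuallyEq hev

theorem contDiff_logPull {F : ℝ × ℝ → E} (k : ℕ) (hF : ∀ n, ExpControl n (k + 1) F) :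
    ContDiff ℝ k (logPull F) := by
  have hd := hasFDerivAt_logPull (hF 0).1 fun n => (hF n).2.1
  induction k generalizing E with
  | zero => exact contDiff_zero.2 (continuous_iff_continuousAt.2 fun p => (hd p).continuousAt)
  | succ k ih =>
    have h2 := fun n => ExpControl.logFDeriv hF n
    push_cast
    refine contDiff_succ_iff_fderiv.2 ⟨fun p => (hd p).differentiableAt, by simp, ?_⟩
    rw [show fderiv ℝ (logPull F) = _ from funext fun p => (hd p).fderiv]
    exact ih h2 (hasFDerivAt_logPull (h2 0).1 fun n => (h2 n).2.1)

end Extension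

section Borel

theorem iterate_pt_eq_iteratedFDeriv {u : ℝ → ℝ → ℝ} (hu : Smooth2 u) (k : ℕ) (t x : ℝ) :
    pt^[k] u t x =
      iteratedFDeriv ℝ k (fun p : ℝ × ℝ => u p.1 p.2) (t, x) fun _ => (1, 0) := by
  induction k generalizing t x with
  | zero => simp
  | succ k ih =>
    have hd : DifferentiableAt ℝ (iteratedFDeriv ℝ k fun p : ℝ × ℝ => u p.1 p.2) (t, x) :=
      ContDiff.differentiable_iteratedFDeriv (n := (⊤ : ℕ∞))
        (by exact_mod_cast WithTop.coe_lt_top k) hu (t, x)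
    have h1 := (hd.hasFDerivAt.comp_hasDerivAt (f := fun s => (s, x)) t
      ((hasDerivAt_id t).prodMk (hasDerivAt_const t x)))
    have h2 := (ContinuousMultilinearMap.apply ℝ (fun _ : Fin k => ℝ × ℝ) ℝ
      fun _ => (1, 0)).hasFDerivAt.comp_hasDerivAt t h1
    rw [Function.iterate_succ_apply', iteratedFDeriv_succ_apply_left]
    refine Eq.trans ?_ h2.deriv
    exact congrArg (fun g : ℝ → ℝ => deriv g t) (funext fun s => ih s x)

theorem exists_bound_iteratedFDeriv {H : ℝ × ℝ → ℝ} (hH : ContDiff ℝ (⊤ : ℕ∞) H)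
    (hper : ∀ p : ℝ × ℝ, H (p + (0, 2 * Real.pi)) = H p) (hsupp : ∀ p : ℝ × ℝ, 2 ≤ |p.1| → H p = 0)
    (k : ℕ) : ∃ C : ℝ, ∀ p, ‖iteratedFDeriv ℝ k H p‖ ≤ C := by
  have hc : Continuous (iteratedFDeriv ℝ k H) :=
    hH.continuous_iteratedFDeriv (by exact_mod_cast le_top)
  obtain ⟨C, hC⟩ := (isCompact_Icc.prod isCompact_Icc :
    IsCompact (Icc (-2) (2 : ℝ) ×ˢ Icc (0 : ℝ) (2 * Real.pi))).exists_bound_of_continuousOn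
      hc.continuousOn
  have hC0 : 0 ≤ C := (norm_nonneg _).trans
    (hC (0, 0) ⟨by norm_num, le_rfl, Real.two_pi_pos.le⟩)
  refine ⟨C, fun p => ?_⟩
  rcases le_or_gt |p.1| 2 with hp | hp
  · have hk : Function.Periodic (fun y => iteratedFDeriv ℝ k H (p.1, y)) (2 * Real.pi) := by
      intro y
      have := iteratedFDeriv_comp_add_right (𝕜 := ℝ) (f := H) k (0, 2 * Real.pi) (p.1, y)
      rw [show (fun z => H (z + (0, 2 * Real.pi))) = H from funext hper] at this
      simpa using this.symm
    obtain ⟨y, hy, hxy⟩ := hk.exists_mem_Ico₀ Real.two_pi_pos p.2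
    rw [← Prod.mk.eta (p := p), hxy]
    exact hC (p.1, y) ⟨abs_le.1 hp, hy.1, hy.2.le⟩
  · have hev : H =ᶠ[𝓝 p] fun _ => 0 := by
      filter_upwards [continuous_fst.abs.continuousAt.eventually (lt_mem_nhds hp)] with q hq
      exact hsupp q hq.le
    rw [(hev.iteratedFDeriv ℝ k).eq_of_nhds]
    simpa [iteratedFDeriv_fun_zero] using hC0

theorem norm_iteratedFDeriv_scale_le {H : ℝ × ℝ → ℝ} (hH : ContDiff ℝ (⊤ : ℕ∞) H) {k : ℕ} {C : ℝ}
    (hC : ∀ p, ‖iteratedFDeriv ℝ k H p‖ ≤ C) {e : ℝ} (he : 0 < e) (he1 : e ≤ 1) (n : ℕ)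
    (p : ℝ × ℝ) :
    ‖iteratedFDeriv ℝ k (fun q : ℝ × ℝ => e ^ n * H (e⁻¹ * q.1, q.2)) p‖ ≤
      e ^ n * (C * e⁻¹ ^ k) := by
  set L : ℝ × ℝ →L[ℝ] ℝ × ℝ := (e⁻¹ • ContinuousLinearMap.fst ℝ ℝ ℝ).prod
    (ContinuousLinearMap.snd ℝ ℝ ℝ) with hL
  have hLn : ‖L‖ ≤ e⁻¹ := by
    have h1 : 1 ≤ e⁻¹ := (one_le_inv₀ he).2 he1
    refine ContinuousLinearMap.opNorm_le_bound _ (by positivity) fun q => ?_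
    refine max_le ?_ ?_
    · simp only [hL, ContinuousLinearMap.prod_apply, smul_apply, norm_smul,
        Real.norm_of_nonneg (inv_nonneg.2 he.le)]
      gcongr
      exact norm_fst_le q
    · exact (norm_snd_le q).trans (le_mul_of_one_le_left (norm_nonneg _) h1)
  have hcomp : ContDiff ℝ (⊤ : ℕ∞) (H ∘ L) := hH.comp L.contDiff
  have hk : ((k : ℕ∞) : WithTop ℕ∞) ≤ (⊤ : ℕ∞) := by exact_mod_cast le_top
  have h1 : (fun q : ℝ × ℝ => e ^ n * H (e⁻¹ * q.1, q.2)) = e ^ n • (H ∘ L) := rfl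
  have hck : ContDiff ℝ k (H ∘ L) := hcomp.of_le hk
  rw [h1, iteratedFDeriv_const_smul_apply hck.contDiffAt, norm_smul,
    Real.norm_of_nonneg (by positivity), L.iteratedFDeriv_comp_right hH p hk]
  gcongr
  refine (ContinuousMultilinearMap.norm_compContinuousLinearMap_le _ _).trans ?_
  rw [Finset.prod_const, Finset.card_univ, Fintype.card_fin]
  have hC0 : 0 ≤ C := (norm_nonneg _).trans (hC 0)
  gcongr
  exact hC _

theorem exists_scale {H : ℕ → ℝ × ℝ → ℝ} (hH : ∀ n, ContDiff ℝ (⊤ : ℕ∞) (H n))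
    (hb : ∀ n k, ∃ C : ℝ, ∀ p, ‖iteratedFDeriv ℝ k (H n) p‖ ≤ C) :
    ∃ e : ℕ → ℝ, (∀ n, 0 < e n) ∧ ∃ v : ℕ → ℕ → ℝ, (∀ k, Summable (v k)) ∧
      ∀ k n p, ‖iteratedFDeriv ℝ k
        (fun q : ℝ × ℝ => e n ^ n * H n ((e n)⁻¹ * q.1, q.2)) p‖ ≤ v k n := by
  choose C hC using hb
  have hC0 : ∀ n k, 0 ≤ C n k := fun n k => (norm_nonneg _).trans (hC n k 0)
  have hS : ∀ n, 0 ≤ 2 ^ n * ∑ k ∈ Finset.range n, C n k := fun n =>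
    mul_nonneg (by positivity) (Finset.sum_nonneg fun k _ => hC0 n k)
  set e : ℕ → ℝ := fun n => (1 + 2 ^ n * ∑ k ∈ Finset.range n, C n k)⁻¹ with he
  have he0 : ∀ n, 0 < e n := fun n => inv_pos.2 (by linarith [hS n])
  have he1 : ∀ n, e n ≤ 1 := fun n => inv_le_one_of_one_le₀ (by linarith [hS n])
  refine ⟨e, he0, fun k n => if k < n then (1 / 2) ^ n else e n ^ n * (C n k * (e n)⁻¹ ^ k),
    fun k => ?_, fun k n p => ?_⟩
  · refine summable_geometric_two.congr_cofinite ?_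
    rw [Nat.cofinite_eq_atTop]
    filter_upwards [eventually_gt_atTop k] with n hn
    exact (if_pos hn).symm
  · have h := norm_iteratedFDeriv_scale_le (hH n) (hC n k) (he0 n) (he1 n) n p
    beta_reduce
    split_ifs with hkn
    · refine h.trans ?_
      have h1 : e n ^ n * (e n)⁻¹ ^ k ≤ e n := by
        obtain ⟨m, rfl⟩ := Nat.exists_eq_add_of_lt hkn
        rw [add_assoc, pow_add, mul_right_comm, ← mul_pow, mul_inv_cancel₀ (he0 _).ne', one_pow,
          one_mul, pow_succ]
        exact mul_le_of_le_one_left (he0 _).le (pow_le_one₀ (he0 _).le (he1 _))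
      have h2 : C n k ≤ ∑ k ∈ Finset.range n, C n k :=
        Finset.single_le_sum (fun k _ => hC0 n k) (Finset.mem_range.2 hkn)
      calc e n ^ n * (C n k * (e n)⁻¹ ^ k) = (e n ^ n * (e n)⁻¹ ^ k) * C n k := by ring
        _ ≤ e n * C n k := mul_le_mul_of_nonneg_right h1 (hC0 n k)
        _ ≤ (1 / 2) ^ n := by
          rw [he]
          beta_reduce
          rw [inv_mul_le_iff₀ (by linarith [hS n]), add_mul, mul_right_comm, ← mul_pow]
          norm_num
          have : (0 : ℝ) < (1 / 2) ^ n := by positivity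
          linarith
    · exact h

theorem smooth2_tsum {h : ℕ → ℝ → ℝ → ℝ} (hh : ∀ n, Smooth2 (h n)) {v : ℕ → ℕ → ℝ}
    (hv : ∀ k, Summable (v k))
    (hle : ∀ k n p, ‖iteratedFDeriv ℝ k (fun q : ℝ × ℝ => h n q.1 q.2) p‖ ≤ v k n) :
    Smooth2 (fun t x => ∑' n, h n t x) :=
  contDiff_tsum (N := ⊤) hh (fun k _ => hv k) fun k n p _ => hle k n p

theorem iterate_pt_tsum {h : ℕ → ℝ → ℝ → ℝ} (hh : ∀ n, Smooth2 (h n)) {v : ℕ → ℕ → ℝ}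
    (hv : ∀ k, Summable (v k))
    (hle : ∀ k n p, ‖iteratedFDeriv ℝ k (fun q : ℝ × ℝ => h n q.1 q.2) p‖ ≤ v k n)
    (k : ℕ) (t x : ℝ) :
    pt^[k] (fun t x => ∑' n, h n t x) t x = ∑' n, pt^[k] (h n) t x := by
  have h1 := iteratedFDeriv_tsum (N := ⊤) (f := fun n (q : ℝ × ℝ) => h n q.1 q.2) hh
    (fun k _ => hv k) (fun k n p _ => hle k n p) (k := k) le_top
  have h2 : Summable fun n => iteratedFDeriv ℝ k (fun q : ℝ × ℝ => h n q.1 q.2) (t, x) :=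
    Summable.of_norm_bounded (hv k) fun n => hle k n (t, x)
  rw [iterate_pt_eq_iteratedFDeriv (smooth2_tsum hh hv hle), h1]
  refine (ContinuousMultilinearMap.tsum_eval h2 _).trans (tsum_congr fun n => ?_)
  rw [iterate_pt_eq_iteratedFDeriv (hh n)]

/-- Borel's lemma with periodic parameters. -/
theorem exists_smooth2_iterate_pt_eq {φ : ℕ → ℝ → ℝ} (hφ : ∀ n, ContDiff ℝ (⊤ : ℕ∞) (φ n))
    (hper : ∀ n, Function.Periodic (φ n) (2 * Real.pi)) :
    ∃ W : ℝ → ℝ → ℝ, Smooth2 W ∧ Periodic2 W ∧ ∀ k x, pt^[k] W 0 x = φ k x := by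
  obtain ⟨χ, hχ, hχ1, hχ0⟩ : ∃ χ : ℝ → ℝ, ContDiff ℝ (⊤ : ℕ∞) χ ∧ (∀ t, |t| ≤ 1 → χ t = 1) ∧
      ∀ t, 2 ≤ |t| → χ t = 0 := by
    let χ : ContDiffBump (0 : ℝ) := ⟨1, 2, one_pos, one_lt_two⟩
    exact ⟨χ, χ.contDiff, fun t ht => χ.one_of_mem_closedBall (by simpa [χ] using ht),
      fun t ht => χ.zero_of_le_dist (by simpa using ht)⟩
  have hH : ∀ n, ContDiff ℝ (⊤ : ℕ∞)
      (fun p : ℝ × ℝ => χ p.1 * (p.1 ^ n / n.factorial) * φ n p.2) := fun n =>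
    ((hχ.comp contDiff_fst).mul ((contDiff_fst.pow n).div_const _)).mul
      ((hφ n).comp contDiff_snd)
  have hb : ∀ n k, ∃ C : ℝ, ∀ p, ‖iteratedFDeriv ℝ k
      (fun p : ℝ × ℝ => χ p.1 * (p.1 ^ n / n.factorial) * φ n p.2) p‖ ≤ C := by
    intro n
    refine exists_bound_iteratedFDeriv (hH n) (fun p => ?_) fun p hp => ?_
    · simp only [Prod.fst_add, Prod.snd_add, add_zero, hper n p.2]
    · simp [hχ0 _ hp]
  obtain ⟨e, he, v, hv, hle⟩ := exists_scale hH hb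
  set h : ℕ → ℝ → ℝ → ℝ := fun n t x =>
    e n ^ n * (χ ((e n)⁻¹ * t) * (((e n)⁻¹ * t) ^ n / n.factorial) * φ n x) with hdef
  have hsm : ∀ n, Smooth2 (h n) := fun n =>
    contDiff_const.mul ((hH n).comp ((contDiff_const.mul contDiff_fst).prodMk contDiff_snd))
  have hjet : ∀ n k x, pt^[k] (h n) 0 x = if n = k then φ n x else 0 := by
    intro n k x
    have hev : (fun s => h n s x) =ᶠ[𝓝 0] fun s => φ n x / n.factorial * s ^ n := by
      filter_upwards [Metric.ball_mem_nhds (0 : ℝ) (he n)] with s hs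
      have h1 : χ ((e n)⁻¹ * s) = 1 := by
        refine hχ1 _ ?_
        rw [abs_mul, abs_inv, abs_of_pos (he n), inv_mul_le_iff₀ (he n), mul_one]
        simpa using (mem_ball_zero_iff.1 hs).le
      have h2 : e n ^ n * (e n)⁻¹ ^ n = 1 := by
        rw [← mul_pow, mul_inv_cancel₀ (he n).ne', one_pow]
      simp only [h, h1, one_mul, mul_pow]
      linear_combination (s ^ n / n.factorial * φ n x) * h2
    rw [iterate_pt_eq_iteratedDeriv, hev.iteratedDeriv_eq, iteratedDeriv_const_mul_field,
      iteratedDeriv_fun_pow_zero]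
    by_cases hnk : n = k
    · rw [if_pos hnk.symm, if_pos hnk]
      exact div_mul_cancel₀ _ (by positivity)
    · rw [if_neg (Ne.symm hnk), if_neg hnk, Nat.cast_zero, mul_zero]
  refine ⟨fun t x => ∑' n, h n t x, smooth2_tsum hsm hv hle, fun t x => ?_, fun k x => ?_⟩
  · simp only [h, hper _ x]
  · rw [iterate_pt_tsum hsm hv hle]
    simp only [hjet]
    exact tsum_ite_eq k _

end Borel

theorem ExpControl.of_le {E : Type} [NormedAddCommGroup E] [NormedSpace ℝ E] {n m : ℝ}
    (hnm : n ≤ m) {k : ℕ} {f : ℝ × ℝ → E} (hf : ExpControl m k f) : ExpControl n k f := by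
  induction k generalizing E with
  | zero => exact ⟨hf.1, hf.2.of_le hnm⟩
  | succ k ih => exact ⟨hf.1, hf.2.1.of_le hnm, ih hf.2.2⟩

theorem ExpControl.fderiv_apply {E : Type} [NormedAddCommGroup E] [NormedSpace ℝ E] {n : ℝ}
    {k : ℕ} {f : ℝ × ℝ → E} (hf : ExpControl n (k + 1) f) (v : ℝ × ℝ) :
    ExpControl n k fun q => fderiv ℝ f q v :=
  hf.2.2.clm (ContinuousLinearMap.apply ℝ E v)

theorem expControl_expPull_of_flat {u : ℝ → ℝ → ℝ} (hu : ∀ n, VanishesTo n u) (k : ℕ) (n : ℝ) :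
    ExpControl n k (expPull u) :=
  ((hu ⌈n⌉₊).expControl k).of_le (Nat.le_ceil n)

section Equation

variable {a b c : ℝ → ℝ → ℝ}

/-- The directions integrated along in the integral form of the equation. -/
def slopes : Fin 3 → List ℝ := ![[0], [2], [0, 2]]

/-- The coefficients of the integral form of the equation. -/
noncomputable def coeff (a b c : ℝ → ℝ → ℝ) : Fin 3 → ℝ × ℝ → ℝ →L[ℝ] ℝ :=
  ![fun p => ContinuousLinearMap.mul ℝ ℝ (expPull (fun t x => 1 / 2 * (t * a t x)) p),
    fun p => ContinuousLinearMap.mul ℝ ℝ (expPull (fun t x => -1 / 2 * (t * a t x) - b t x) p),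
    fun p => ContinuousLinearMap.mul ℝ ℝ (expPull (fun t x => -1 * (t * c t x)) p)]

theorem slopes_ne_nil (k : Fin 3) : slopes k ≠ [] := by
  fin_cases k <;> simp [slopes]

theorem expControl_coeff (ha : VanishesTo 0 a) (hb : VanishesTo 0 b) (hc : VanishesTo 0 c)
    (d : ℕ) (k : Fin 3) : ExpControl 0 d (coeff a b c k) := by
  have h : ∀ {u : ℝ → ℝ → ℝ}, VanishesTo 0 u →
      ExpControl 0 d fun p => ContinuousLinearMap.mul ℝ ℝ (expPull u p) := by
    intro u hu
    have := (hu.expControl d).clm (ContinuousLinearMap.mul ℝ ℝ)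
    simpa using this
  fin_cases k
  · exact h ((vanishesTo_const _).mul (vanishesTo_time.mul ha))
  · exact h (((vanishesTo_const _).mul (vanishesTo_time.mul ha)).sub hb)
  · exact h ((vanishesTo_const _).mul (vanishesTo_time.mul hc))

theorem expPull_periodic {u : ℝ → ℝ → ℝ} (hu : Periodic2 u) (p : ℝ × ℝ) :
    expPull u (p + (0, 2 * Real.pi)) = expPull u p := by
  simp only [expPull, Prod.fst_add, Prod.snd_add, add_zero]
  exact hu _ _

theorem coeff_periodic (ha : Periodic2 a) (hb : Periodic2 b) (hc : Periodic2 c) (k : Fin 3)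
    (p : ℝ × ℝ) : coeff a b c k (p + (0, 2 * Real.pi)) = coeff a b c k p := by
  have h : ∀ {u : ℝ → ℝ → ℝ}, Periodic2 u → ContinuousLinearMap.mul ℝ ℝ
      (expPull u (p + (0, 2 * Real.pi))) = ContinuousLinearMap.mul ℝ ℝ (expPull u p) :=
    fun hu => by rw [expPull_periodic hu]
  fin_cases k
  · exact h fun t x => by simp only [ha t x]
  · exact h fun t x => by simp only [ha t x, hb t x]
  · exact h fun t x => by simp only [hc t x]

theorem exp_mul_misnerP {y : ℝ → ℝ → ℝ} (hy : Smooth2 y) (p : ℝ × ℝ) :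
    Real.exp p.1 * MisnerP a b c y (Real.exp p.1) p.2 =
      fderiv ℝ (fun q => fderiv ℝ (expPull y) q (1, 0)) p (1, -2) +
      Real.exp p.1 * a (Real.exp p.1) p.2 * fderiv ℝ (expPull y) p (0, 1) +
      b (Real.exp p.1) p.2 * fderiv ℝ (expPull y) p (1, 0) +
      Real.exp p.1 * c (Real.exp p.1) p.2 * expPull y p := by
  have hs : Smooth2 (fun t x => t * pt y t x) := smooth2_mul smooth2_time (smooth2_pt hy)
  have h1 : (fun q => fderiv ℝ (expPull y) q (1, 0)) = expPull (fun t x => t * pt y t x) := by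
    ext q
    rw [(hasFDerivAt_expPull hy q).fderiv]
    simp
  have h2 : px (fun t x => t * pt y t x) = fun t x => t * px (pt y) t x := by
    ext t x
    exact ((hasDerivAt_px (smooth2_pt hy) t x).const_mul t).deriv
  rw [h1, (hasFDerivAt_expPull hs p).fderiv, (hasFDerivAt_expPull hy p).fderiv,
    pt_time_mul (smooth2_pt hy), h2]
  simp [expPull, MisnerP]
  ring

/-- The wave equation in integral form, for the principal part `Z` of the solution. -/
theorem exp_mul_misnerP_of_rayInts {Z : ℝ × ℝ → ℝ} (hZ : ExpControl 1 1 Z) {y : ℝ → ℝ → ℝ}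
    (hy : Smooth2 y) (hyZ : expPull y = rayInts [0, 2] Z) (p : ℝ × ℝ) :
    Real.exp p.1 * MisnerP a b c y (Real.exp p.1) p.2 =
      Z p - ∑ k, coeff a b c k p (rayInts (slopes k) Z p) := by
  have h1 : (fun q => fderiv ℝ (expPull y) q (1, 0)) = rayInt 2 Z := by
    ext q
    have := fderiv_rayInt_directional one_pos (hZ.rayInt one_pos 2) 0 q
    rw [neg_zero] at this
    rw [hyZ]
    exact this
  have h2 : fderiv ℝ (expPull y) p (1, -2) = rayInt 0 Z p := by
    rw [hyZ, (hasFDerivAt_rayInts one_pos hZ [0, 2] p).fderiv]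
    have := clm_rayInts one_pos hZ.2.2 (ContinuousLinearMap.apply ℝ ℝ ((1, -2) : ℝ × ℝ)) [0, 2] p
    refine this.symm.trans (congrArg (fun f => rayInt 0 f p) (funext fun q => ?_))
    exact rayInt_directional one_pos hZ 2 q
  have h3 : fderiv ℝ (expPull y) p (0, 1) = (rayInt 2 Z p - rayInt 0 Z p) / 2 := by
    have h4 : ((1, -2) : ℝ × ℝ) = (1, 0) - (2 : ℝ) • (0, 1) := by ext <;> simp
    rw [h4, map_sub, map_smul, congrFun h1 p, smul_eq_mul] at h2
    linarith
  rw [exp_mul_misnerP hy, h1, fderiv_rayInt_directional one_pos hZ, h3, congrFun h1 p, hyZ,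
    Fin.sum_univ_three]
  simp only [coeff, slopes, expPull, rayInts, Matrix.cons_val, List.foldr,
    ContinuousLinearMap.mul_apply']
  ring

theorem iterate_pt_eq_zero_of_nonpos {y : ℝ → ℝ → ℝ} (hy : Smooth2 y)
    (h0 : ∀ t x, t ≤ 0 → y t x = 0) (k : ℕ) (x : ℝ) : pt^[k] y 0 x = 0 := by
  have hneg : ∀ t < 0, pt^[k] y t x = 0 := by
    intro t ht
    have hev : (fun s => y s x) =ᶠ[𝓝 t] fun _ => 0 := by
      filter_upwards [gt_mem_nhds ht] with s hs using h0 s x hs.le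
    rw [iterate_pt_eq_iteratedDeriv, hev.iteratedDeriv_eq]
    simp
  have hc : Continuous fun t => pt^[k] y t x :=
    (ContDiff.continuous (smooth2_iterate_pt hy k)).comp (continuous_id.prodMk continuous_const)
  refine tendsto_nhds_unique (hc.continuousAt.tendsto.mono_left
    (nhdsWithin_le_nhds (s := Iio 0))) (tendsto_const_nhds.congr' ?_)
  filter_upwards [self_mem_nhdsWithin] with t ht using (hneg t ht).symm

theorem exists_flat_solution (ha : VanishesTo 0 a) (hb : VanishesTo 0 b) (hc : VanishesTo 0 c)
    {g : ℝ → ℝ → ℝ} (hg : ∀ n, VanishesTo n g) :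
    ∃ y, (∀ n, VanishesTo n y) ∧ ∀ t x, 0 < t → MisnerP a b c y t x = g t x := by
  set G : ℝ × ℝ → ℝ := expPull fun t x => t * g t x with hG
  have hGc : ∀ d n, ExpControl n d G :=
    expControl_expPull_of_flat fun n => vanishesTo_time.mul (hg n)
  set Z := picardSum slopes (coeff a b c) G with hZ
  have hZc : ∀ d n, ExpControl n d Z := fun d n =>
    picardSum_flat slopes_ne_nil d (expControl_coeff ha hb hc d) (hGc d) n
  have hFc : ∀ d n, ExpControl n d (rayInts [0, 2] Z) := fun d n =>
    ((hZc d (max n 1)).rayInts (one_pos.trans_le (le_max_right n 1)) [0, 2]).of_le (le_max_left n 1)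
  have hFp : ∀ p, rayInts [0, 2] Z (p + (0, 2 * Real.pi)) = rayInts [0, 2] Z p :=
    rayInts_periodic (picardSum_periodic (coeff_periodic ha.periodic hb.periodic hc.periodic)
      (expPull_periodic fun t x => by simp only [(hg 0).periodic t x])) _
  set y : ℝ → ℝ → ℝ := fun t x => logPull (rayInts [0, 2] Z) (t, x) with hy
  have hys : Smooth2 y :=
    contDiff_infty.2 fun k => contDiff_logPull k (hFc (k + 1))
  have hyp : Periodic2 y := by
    intro t x
    have := hFp (Real.log t, x)
    simp only [Prod.mk_add_mk, add_zero] at this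
    simp only [hy, logPull, this]
  have hyZ : expPull y = rayInts [0, 2] Z := by
    ext p
    simp [expPull, hy, logPull, Real.exp_pos]
  refine ⟨y, fun n => vanishesTo_iff.2 ⟨hys, hyp, fun k _ => iterate_pt_eq_zero_of_nonpos hys
    (fun t x ht => if_neg ht.not_gt) k⟩, fun t x ht => ?_⟩
  have h1 := exp_mul_misnerP_of_rayInts (a := a) (b := b) (c := c) (hZc 1 1) hys hyZ (Real.log t, x)
  have h2 := picardSum_eq slopes_ne_nil (expControl_coeff ha hb hc 0) (hGc 0) (Real.log t, x)
  rw [← hZ] at h2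
  have h3 : G (Real.log t, x) = t * g t x := by simp [hG, expPull, Real.exp_log ht]
  rw [h3] at h2
  simp only [Real.exp_log ht] at h1
  exact mul_left_cancel₀ ht.ne' (by linarith)

theorem eq_zero_of_flat (ha : VanishesTo 0 a) (hb : VanishesTo 0 b) (hc : VanishesTo 0 c)
    {d : ℝ → ℝ → ℝ} (hd : ∀ n, VanishesTo n d) (hP : ∀ t x, 0 < t → MisnerP a b c d t x = 0)
    (t x : ℝ) (ht : 0 < t) : d t x = 0 := by
  have hdc := expControl_expPull_of_flat hd
  set Z : ℝ × ℝ → ℝ := fun p =>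
    fderiv ℝ (fun q => fderiv ℝ (expPull d) q (1, 0)) p (1, -2) with hZ
  have hZc : ∀ n, ExpControl n 1 Z := fun n => ((hdc 3 n).fderiv_apply _).fderiv_apply _
  have h2 : rayInt 2 Z = fun q => fderiv ℝ (expPull d) q (1, 0) :=
    funext (rayInt_directional one_pos ((hdc 2 1).fderiv_apply _) 2)
  have hdZ : expPull d = rayInts [0, 2] Z := by
    ext p
    have := rayInt_directional one_pos (hdc 1 1) 0 p
    rw [neg_zero, ← h2] at this
    exact this.symm
  have hZ0 : Z = fun _ => 0 := by
    ext p
    refine eq_zero_of_eq_sum_rayInts slopes_ne_nil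
      (fun k => (expControl_coeff ha hb hc 0 k).expBound) (fun n => (hZc n).expBound)
      (fun q => ?_) p
    have := exp_mul_misnerP_of_rayInts (a := a) (b := b) (c := c) (hZc 1) (hd 0).smooth hdZ q
    rw [hP _ _ (Real.exp_pos _), mul_zero] at this
    linarith
  have h := congrFun hdZ (Real.log t, x)
  rw [hZ0] at h
  simpa [expPull, Real.exp_log ht, rayInts, rayInt] using h

end Equation

theorem iterate_pt_eq_of_coherent {w : ℕ → ℝ → ℝ → ℝ} (hw : ∀ N, Smooth2 (w N))
    (hcoh : ∀ N k : ℕ, k ≤ N → ∀ x : ℝ, pt^[k] (fun t x => w N t x - w (N + 1) t x) 0 x = 0)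
    {N k : ℕ} (hk : k ≤ N) (x : ℝ) : pt^[k] (w N) 0 x = pt^[k] (w k) 0 x := by
  induction N, hk using Nat.le_induction with
  | base => rfl
  | succ N hN ih =>
    have h := hcoh N k hN x
    rw [iterate_pt_sub (hw N) (hw (N + 1))] at h
    linarith

end Misner

/-- Existence and uniqueness on the globally hyperbolic region of the Misner
spacetime, given an asymptotic solution up to any order at the Cauchy horizon. -/
theorem stmt0 (a b c f : ℝ → ℝ → ℝ)
    (ha : Smooth2 a) (hap : Periodic2 a)
    (hb : Smooth2 b) (hbp : Periodic2 b)
    (hc : Smooth2 c) (hcp : Periodic2 c)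
    (hf : Smooth2 f) (hfp : Periodic2 f)
    (w : ℕ → ℝ → ℝ → ℝ)
    (hw : ∀ N : ℕ, Smooth2 (w N) ∧ Periodic2 (w N))
    (hasym : ∀ (N k : ℕ), k ≤ N → ∀ x : ℝ,
      pt^[k] (fun t x => MisnerP a b c (w N) t x - f t x) 0 x = 0)
    (hcoh : ∀ (N k : ℕ), k ≤ N → ∀ x : ℝ,
      pt^[k] (fun t x => w N t x - w (N + 1) t x) 0 x = 0) :
    ∃ u : ℝ → ℝ → ℝ,
      (Smooth2 u ∧ Periodic2 u ∧
        (∀ t x : ℝ, 0 < t → MisnerP a b c u t x = f t x) ∧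
        (∀ (N k : ℕ), k ≤ N → ∀ x : ℝ, pt^[k] u 0 x = pt^[k] (w N) 0 x)) ∧
      (∀ v : ℝ → ℝ → ℝ,
        (Smooth2 v ∧ Periodic2 v ∧
          (∀ t x : ℝ, 0 < t → MisnerP a b c v t x = f t x) ∧
          (∀ (N k : ℕ), k ≤ N → ∀ x : ℝ, pt^[k] v 0 x = pt^[k] (w N) 0 x)) →
        ∀ t x : ℝ, 0 ≤ t → v t x = u t x) := by
  have hjet : ∀ {N k : ℕ}, k ≤ N → ∀ x, pt^[k] (w N) 0 x = pt^[k] (w k) 0 x :=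
    fun hk x => Misner.iterate_pt_eq_of_coherent (fun N => (hw N).1) hcoh hk x
  have ha0 : Misner.VanishesTo 0 a := ⟨ha, hap⟩
  have hb0 : Misner.VanishesTo 0 b := ⟨hb, hbp⟩
  have hc0 : Misner.VanishesTo 0 c := ⟨hc, hcp⟩
  obtain ⟨W, hWs, hWp, hW⟩ := Misner.exists_smooth2_iterate_pt_eq
    (φ := fun k x => pt^[k] (w k) 0 x)
    (fun k => (Misner.smooth2_iterate_pt (hw k).1 k).comp (contDiff_const.prodMk contDiff_id))
    (fun k x => Misner.periodic2_iterate_pt (hw k).2 k 0 x)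
  have hg : ∀ n, Misner.VanishesTo n fun t x => f t x - MisnerP a b c W t x := by
    intro n
    have hw0 : Misner.VanishesTo 0 (w (n + 2)) := hw (n + 2)
    have hw1 : Misner.VanishesTo 0 (pt (w (n + 2))) :=
      ⟨Misner.smooth2_pt hw0.1, Misner.periodic2_pt hw0.2⟩
    have hw2 : Misner.VanishesTo 0 (pt (pt (w (n + 2)))) :=
      ⟨Misner.smooth2_pt hw1.1, Misner.periodic2_pt hw1.2⟩
    have hwP : Misner.VanishesTo n fun t x => MisnerP a b c (w (n + 2)) t x - f t x := by
      have h0 := (Misner.VanishesTo.misnerP ha0 hb0 hc0 hw0 hw1 hw2).sub ⟨hf, hfp⟩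
      exact Misner.vanishesTo_iff.2 ⟨h0.1, h0.2, fun k hk => hasym (n + 2) k (by omega)⟩
    have hWw : Misner.VanishesTo (n + 2) fun t x => W t x - w (n + 2) t x := by
      have h0 : Misner.VanishesTo 0 fun t x => W t x - w (n + 2) t x :=
        Misner.VanishesTo.sub ⟨hWs, hWp⟩ hw0
      refine Misner.vanishesTo_iff.2 ⟨h0.1, h0.2, fun k hk x => ?_⟩
      rw [Misner.iterate_pt_sub hWs hw0.1, hW, ← hjet hk.le, sub_self]
    have h := ((Misner.vanishesTo_const (-1)).mul hwP).sub
      (Misner.VanishesTo.misnerP ha0 hb0 hc0 hWw.of_succ.of_succ hWw.pt.of_succ hWw.pt.pt)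
    refine (congrArg (Misner.VanishesTo n) (funext₂ fun t x => ?_)).mp h
    rw [Misner.misnerP_sub hWs hw0.1]
    ring
  obtain ⟨y, hy, hyP⟩ := Misner.exists_flat_solution ha0 hb0 hc0 hg
  have hys := (hy 0).smooth
  have hus : Smooth2 fun t x => y t x + W t x := Misner.smooth2_add hys hWs
  have hup : Periodic2 fun t x => y t x + W t x := Misner.periodic2_add (hy 0).periodic hWp
  have huP : ∀ t x : ℝ, 0 < t → MisnerP a b c (fun t x => y t x + W t x) t x = f t x := by
    intro t x ht
    have h := Misner.misnerP_sub (a := a) (b := b) (c := c) hus hWs t x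
    simp only [add_sub_cancel_right] at h
    linarith [hyP t x ht]
  have huj : ∀ N k : ℕ, k ≤ N → ∀ x : ℝ,
      pt^[k] (fun t x => y t x + W t x) 0 x = pt^[k] (w N) 0 x := by
    intro N k hk x
    rw [Misner.iterate_pt_add hys hWs, hW, hjet hk,
      (Misner.vanishesTo_iff.1 (hy (k + 1))).2.2 k k.lt_succ_self, zero_add]
  refine ⟨_, ⟨hus, hup, huP, huj⟩, ?_⟩
  rintro v ⟨hvs, hvp, hvP, hvj⟩ t x ht
  have hd : ∀ n, Misner.VanishesTo n fun t x => v t x - (y t x + W t x) := by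
    intro n
    have h0 : Misner.VanishesTo 0 fun t x => v t x - (y t x + W t x) :=
      Misner.VanishesTo.sub ⟨hvs, hvp⟩ ⟨hus, hup⟩
    refine Misner.vanishesTo_iff.2 ⟨h0.1, h0.2, fun k _ x => ?_⟩
    rw [Misner.iterate_pt_sub hvs hus, hvj k k le_rfl, huj k k le_rfl, sub_self]
  refine sub_eq_zero.1 ?_
  rcases ht.eq_or_lt with rfl | ht
  · exact (hd 1).2.2.1 x
  · refine Misner.eq_zero_of_flat ha0 hb0 hc0 hd (fun t x ht => ?_) t x ht
    rw [Misner.misnerP_sub hvs hus, hvP t x ht, huP t x ht, sub_self]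
end

section
/- Let Pu = t·∂_t²u − 2·∂_x∂_t u + ∂_t u + a·∂_x u + b·∂_t u + c·u with a, b, c smooth on [0,∞)×ℝ and 2π-periodic in x, and assume the admissibility condition b(0,x) ≥ 0 for all x ∈ ℝ. If u is smooth on [0,∞)×ℝ, 2π-periodic in x, satisfies Pu = 0 at every point of (0,∞)×ℝ, and u(0,x) = 0 for all x ∈ ℝ, then u is identically zero on [0,∞)×ℝ. -/
theorem Smooth2.hasFDerivAt {u : ℝ → ℝ → ℝ} (hu : Smooth2 u) (p : ℝ × ℝ) :
    HasFDerivAt (fun p : ℝ × ℝ => u p.1 p.2) (fderiv ℝ (fun p : ℝ × ℝ => u p.1 p.2) p) p :=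
  (hu.differentiable (by simp)).differentiableAt.hasFDerivAt

theorem Smooth2.hasDerivAt_fst {u : ℝ → ℝ → ℝ} (hu : Smooth2 u) (t x : ℝ) :
    HasDerivAt (fun s => u s x) (fderiv ℝ (fun p : ℝ × ℝ => u p.1 p.2) (t, x) (1, 0)) t :=
  (hu.hasFDerivAt (t, x)).comp_hasDerivAt (f := fun s : ℝ => (s, x)) t
    ((hasDerivAt_id t).prodMk (hasDerivAt_const t x))

theorem Smooth2.hasDerivAt_snd {u : ℝ → ℝ → ℝ} (hu : Smooth2 u) (t x : ℝ) :
    HasDerivAt (fun y => u t y) (fderiv ℝ (fun p : ℝ × ℝ => u p.1 p.2) (t, x) (0, 1)) x :=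
  (hu.hasFDerivAt (t, x)).comp_hasDerivAt (f := fun y : ℝ => (t, y)) x
    ((hasDerivAt_const x t).prodMk (hasDerivAt_id x))

theorem Smooth2.pt_eq_fderiv {u : ℝ → ℝ → ℝ} (hu : Smooth2 u) (t x : ℝ) :
    pt u t x = fderiv ℝ (fun p : ℝ × ℝ => u p.1 p.2) (t, x) (1, 0) :=
  (hu.hasDerivAt_fst t x).deriv

theorem Smooth2.px_eq_fderiv {u : ℝ → ℝ → ℝ} (hu : Smooth2 u) (t x : ℝ) :
    px u t x = fderiv ℝ (fun p : ℝ × ℝ => u p.1 p.2) (t, x) (0, 1) :=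
  (hu.hasDerivAt_snd t x).deriv

theorem Smooth2.hasDerivAt_pt {u : ℝ → ℝ → ℝ} (hu : Smooth2 u) (t x : ℝ) :
    HasDerivAt (fun s => u s x) (pt u t x) t :=
  (hu.hasDerivAt_fst t x).differentiableAt.hasDerivAt

theorem Smooth2.hasDerivAt_px {u : ℝ → ℝ → ℝ} (hu : Smooth2 u) (t x : ℝ) :
    HasDerivAt (fun y => u t y) (px u t x) x :=
  (hu.hasDerivAt_snd t x).differentiableAt.hasDerivAt

theorem Smooth2.contDiff_fderiv {u : ℝ → ℝ → ℝ} (hu : Smooth2 u) :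
    ContDiff ℝ (⊤ : ℕ∞) (fderiv ℝ (fun p : ℝ × ℝ => u p.1 p.2)) :=
  ContDiff.fderiv_right hu (by simp)

theorem Smooth2.pt {u : ℝ → ℝ → ℝ} (hu : Smooth2 u) : Smooth2 (pt u) := by
  unfold Smooth2
  simp only [hu.pt_eq_fderiv]
  exact hu.contDiff_fderiv.clm_apply contDiff_const

theorem Smooth2.px {u : ℝ → ℝ → ℝ} (hu : Smooth2 u) : Smooth2 (px u) := by
  unfold Smooth2
  simp only [hu.px_eq_fderiv]
  exact hu.contDiff_fderiv.clm_apply contDiff_const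

/-- Mixed partial derivatives of a smooth function commute. -/
theorem Smooth2.pt_px {u : ℝ → ℝ → ℝ} (hu : Smooth2 u) (t x : ℝ) :
    _root_.pt (_root_.px u) t x = _root_.px (_root_.pt u) t x := by
  have hd : DifferentiableAt ℝ (fderiv ℝ (fun p : ℝ × ℝ => u p.1 p.2)) (t, x) :=
    (hu.contDiff_fderiv.differentiable (by simp)).differentiableAt
  have hs : IsSymmSndFDerivAt ℝ (fun p : ℝ × ℝ => u p.1 p.2) (t, x) :=
    (ContDiff.contDiffAt hu).isSymmSndFDerivAt
      (by simpa using WithTop.coe_le_coe.2 (le_top : (2 : ℕ∞) ≤ ⊤))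
  rw [hu.px.pt_eq_fderiv, hu.pt.px_eq_fderiv]
  simp only [hu.pt_eq_fderiv, hu.px_eq_fderiv]
  rw [fderiv_clm_apply hd (by fun_prop), fderiv_clm_apply hd (by fun_prop)]
  simpa using hs (1, 0) (0, 1)

theorem Smooth2.continuous {u : ℝ → ℝ → ℝ} (hu : Smooth2 u) :
    Continuous (fun p : ℝ × ℝ => u p.1 p.2) := ContDiff.continuous hu

theorem Smooth2.continuous_snd {u : ℝ → ℝ → ℝ} (hu : Smooth2 u) (t : ℝ) :
    Continuous (fun x => u t x) :=
  hu.continuous.comp (Continuous.prodMk_right t)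

theorem Periodic2.pt {u : ℝ → ℝ → ℝ} (hu : Periodic2 u) : Periodic2 (pt u) := by
  intro t x
  simp only [_root_.pt, hu _ x]

/-- A smooth function that is periodic in space is bounded on every compact time interval. -/
theorem Smooth2.exists_bound {g : ℝ → ℝ → ℝ} (hg : Smooth2 g) (hp : Periodic2 g) (T : ℝ) :
    ∃ K, 0 ≤ K ∧ ∀ t ∈ Set.Icc 0 T, ∀ x, |g t x| ≤ K := by
  obtain ⟨K, hK⟩ := ((isCompact_Icc (a := (0 : ℝ)) (b := T)).prod
    (isCompact_Icc (a := (0 : ℝ)) (b := 2 * Real.pi))).exists_bound_of_continuousOn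
      hg.continuous.continuousOn
  refine ⟨max K 0, le_max_right _ _, fun t ht x => ?_⟩
  obtain ⟨y, hy, hxy⟩ := Function.Periodic.exists_mem_Ico₀ (f := g t) (hp t)
    Real.two_pi_pos x
  rw [hxy]
  exact (hK (t, y) ⟨ht, Set.Ico_subset_Icc_self hy⟩).trans (le_max_left _ _)

/-- Differentiation under the integral sign. -/
theorem Smooth2.hasDerivAt_integral {g : ℝ → ℝ → ℝ} (hg : Smooth2 g) (t : ℝ) :
    HasDerivAt (fun s => ∫ x in (0 : ℝ)..2 * Real.pi, g s x)
      (∫ x in (0 : ℝ)..2 * Real.pi, _root_.pt g t x) t := by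
  obtain ⟨K, hK⟩ := ((isCompact_Icc (a := t - 1) (b := t + 1)).prod
    (isCompact_Icc (a := (0 : ℝ)) (b := 2 * Real.pi))).exists_bound_of_continuousOn
      hg.pt.continuous.continuousOn
  refine (intervalIntegral.hasDerivAt_integral_of_dominated_loc_of_deriv_le
    (F := g) (F' := _root_.pt g) (bound := fun _ => K)
    (Icc_mem_nhds (sub_one_lt t) (lt_add_one t))
    (Filter.Eventually.of_forall fun s => (hg.continuous_snd s).aestronglyMeasurable)
    ((hg.continuous_snd t).intervalIntegrable _ _)
    (hg.pt.continuous_snd t).aestronglyMeasurable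
    (Filter.Eventually.of_forall fun x hx s hs => ?_)
    intervalIntegrable_const
    (Filter.Eventually.of_forall fun x _ s _ => hg.hasDerivAt_pt s x)).2
  rw [Set.uIoc_of_le Real.two_pi_pos.le] at hx
  exact hK (s, x) ⟨hs, Set.Ioc_subset_Icc_self hx⟩

theorem integral_px_eq_zero {g : ℝ → ℝ → ℝ} (hg : Smooth2 g) (hp : Periodic2 g) (t : ℝ) :
    ∫ x in (0 : ℝ)..2 * Real.pi, px g t x = 0 := by
  rw [intervalIntegral.integral_eq_sub_of_hasDerivAt (fun x _ => hg.hasDerivAt_px t x)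
    ((hg.px.continuous_snd t).intervalIntegrable _ _)]
  simpa [sub_eq_zero] using hp t 0

theorem energy_flux_le {t T a b c K M p q s : ℝ} (ht : 0 ≤ t) (htT : t ≤ T) (hK : 0 ≤ K)
    (ha : |a| ≤ K) (hb : |b| ≤ K) (hc : |c| ≤ K) (hM : 0 ≤ M) (hbM : -(M * t) ≤ b) :
    -(1 + 2 * b) * p ^ 2 - 2 * p * (a * ((t * p - q) / 2) + c * s)
        - 2 * q * (a * ((t * p - q) / 2) + b * p + c * s) + 2 * s * p
      ≤ (2 * M + 3 * K + (K * (3 + T)) ^ 2 + (2 + 2 * K) ^ 2) *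
          (t * p ^ 2 + q ^ 2 + s ^ 2) := by
  have hα : |a - a * t - 2 * b| ≤ K * (3 + T) := by
    have h1 : |a * t| ≤ K * T := by
      rw [abs_mul, abs_of_nonneg ht]
      exact mul_le_mul ha htT ht hK
    rw [abs_le] at *
    constructor <;> linarith
  have hβ : |2 - 2 * c| ≤ 2 + 2 * K := by
    rw [abs_le] at *
    constructor <;> linarith
  have hα2 := sq_le_sq' (abs_le.1 hα).1 (abs_le.1 hα).2
  have hβ2 := sq_le_sq' (abs_le.1 hβ).1 (abs_le.1 hβ).2
  obtain ⟨ha1, ha2⟩ := abs_le.1 ha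
  obtain ⟨hc1, hc2⟩ := abs_le.1 hc
  have htp : 0 ≤ t * p ^ 2 := by positivity
  have h1 : -b * p ^ 2 ≤ M * t * p ^ 2 :=
    mul_le_mul_of_nonneg_right (by linarith) (sq_nonneg p)
  have h2 : -a * (t * p ^ 2) ≤ K * (t * p ^ 2) :=
    mul_le_mul_of_nonneg_right (by linarith) htp
  have h3 : a * q ^ 2 ≤ K * q ^ 2 := mul_le_mul_of_nonneg_right ha2 (sq_nonneg q)
  have h4 : -2 * c * (q * s) ≤ K * q ^ 2 + K * s ^ 2 := by
    nlinarith [mul_nonneg (sub_nonneg.2 hc2) (sq_nonneg (q - s)),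
      mul_nonneg (neg_le_iff_add_nonneg.1 hc1) (sq_nonneg (q + s))]
  have h5 : (a - a * t - 2 * b) * (p * q) ≤ p ^ 2 / 2 + (K * (3 + T)) ^ 2 * q ^ 2 := by
    nlinarith [sq_nonneg (p - (a - a * t - 2 * b) * q),
      mul_le_mul_of_nonneg_right hα2 (sq_nonneg q), mul_nonneg (sq_nonneg (K * (3 + T))) (sq_nonneg q)]
  have h6 : (2 - 2 * c) * (p * s) ≤ p ^ 2 / 2 + (2 + 2 * K) ^ 2 * s ^ 2 := by
    nlinarith [sq_nonneg (p - (2 - 2 * c) * s),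
      mul_le_mul_of_nonneg_right hβ2 (sq_nonneg s), mul_nonneg (sq_nonneg (2 + 2 * K)) (sq_nonneg s)]
  have r1 := mul_nonneg hM (sq_nonneg q)
  have r2 := mul_nonneg hM (sq_nonneg s)
  have r3 := mul_nonneg hK htp
  have r4 := mul_nonneg hK (sq_nonneg q)
  have r5 := mul_nonneg hK (sq_nonneg s)
  have r6 := mul_nonneg (sq_nonneg (K * (3 + T))) htp
  have r7 := mul_nonneg (sq_nonneg (K * (3 + T))) (sq_nonneg s)
  have r8 := mul_nonneg (sq_nonneg (2 + 2 * K)) htp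
  have r9 := mul_nonneg (sq_nonneg (2 + 2 * K)) (sq_nonneg q)
  linarith

/-- The energy density `t φ² + ψ² + u²`, where `φ = ∂ₜu` and `ψ = t ∂ₜu - 2 ∂ₓu`. -/
noncomputable def energyDensity (u : ℝ → ℝ → ℝ) : ℝ → ℝ → ℝ := fun t x =>
  t * pt u t x ^ 2 + (t * pt u t x - 2 * px u t x) ^ 2 + u t x ^ 2

theorem Smooth2.energyDensity {u : ℝ → ℝ → ℝ} (hu : Smooth2 u) :
    Smooth2 (energyDensity u) := by
  have h1 : ContDiff ℝ (⊤ : ℕ∞) (fun p : ℝ × ℝ => _root_.pt u p.1 p.2) := hu.pt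
  have h2 : ContDiff ℝ (⊤ : ℕ∞) (fun p : ℝ × ℝ => _root_.px u p.1 p.2) := hu.px
  have h3 : ContDiff ℝ (⊤ : ℕ∞) (fun p : ℝ × ℝ => u p.1 p.2) := hu
  unfold Smooth2 _root_.energyDensity
  fun_prop

theorem pt_energyDensity {u : ℝ → ℝ → ℝ} (hu : Smooth2 u) (t x : ℝ) :
    pt (energyDensity u) t x = pt u t x ^ 2 + 2 * pt u t x * (t * pt (pt u) t x)
      + 2 * (t * pt u t x - 2 * px u t x) *
          (pt u t x + t * pt (pt u) t x - 2 * px (pt u) t x)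
      + 2 * u t x * pt u t x := by
  have h1 := hu.pt.hasDerivAt_pt t x
  have h2 := hu.px.hasDerivAt_pt t x
  have h := ((((hasDerivAt_id t).mul (h1.pow 2)).add
    ((((hasDerivAt_id t).mul h1).sub (h2.const_mul 2)).pow 2)).add
      ((hu.hasDerivAt_pt t x).pow 2))
  refine (HasDerivAt.deriv h).trans ?_
  rw [hu.pt_px]
  simp
  ring

/-- For a solution vanishing on the horizon the total energy vanishes, by a Grönwall argument. -/
theorem integral_energyDensity_nonpos {a b c : ℝ → ℝ → ℝ}
    (ha : Smooth2 a) (hap : Periodic2 a) (hb : Smooth2 b) (hbp : Periodic2 b)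
    (hc : Smooth2 c) (hcp : Periodic2 c) (hadm : ∀ x : ℝ, 0 ≤ b 0 x)
    {u : ℝ → ℝ → ℝ} (hu : Smooth2 u) (hup : Periodic2 u)
    (heq : ∀ t x : ℝ, 0 < t → MisnerP a b c u t x = 0)
    (h0 : ∀ x : ℝ, u 0 x = 0) {T : ℝ} (hT : 0 ≤ T) :
    ∫ x in (0 : ℝ)..2 * Real.pi, energyDensity u T x ≤ 0 := by
  obtain ⟨Ka, hKa, haK⟩ := ha.exists_bound hap T
  obtain ⟨Kb, hKb, hbK⟩ := hb.exists_bound hbp T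
  obtain ⟨Kc, hKc, hcK⟩ := hc.exists_bound hcp T
  obtain ⟨M, hM, hbM⟩ := hb.pt.exists_bound hbp.pt T
  have hbM' : ∀ t ∈ Set.Icc 0 T, ∀ x, -(M * t) ≤ b t x := by
    intro t ht x
    have h := (convex_Icc (0 : ℝ) T).norm_image_sub_le_of_norm_hasDerivWithin_le
      (fun s _ => (hb.hasDerivAt_pt s x).hasDerivWithinAt) (fun s hs => hbM s hs x)
      (Set.left_mem_Icc.2 hT) ht
    rw [Real.norm_eq_abs, Real.norm_eq_abs, sub_zero, abs_of_nonneg ht.1] at h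
    linarith [(abs_le.1 h).1, hadm x]
  set K := Ka + Kb + Kc with hK
  set C := 2 * M + 3 * K + (K * (3 + T)) ^ 2 + (2 + 2 * K) ^ 2
  set E : ℝ → ℝ := fun t => ∫ x in (0 : ℝ)..2 * Real.pi, energyDensity u t x
  have hφ : Smooth2 (fun t x => 2 * pt u t x ^ 2) :=
    contDiff_const.mul (ContDiff.pow hu.pt 2)
  have hφp : Periodic2 (fun t x => 2 * pt u t x ^ 2) := fun t x => by
    simp only [hup.pt t x]
  have hpx : ∀ t x, px (fun t x => 2 * pt u t x ^ 2) t x = 4 * pt u t x * px (pt u) t x := by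
    intro t x
    refine (((hu.pt.hasDerivAt_px t x).pow 2).const_mul 2).deriv.trans ?_
    simp
    ring
  have hE' : ∀ t ∈ Set.Ioo 0 T, ∫ x in (0 : ℝ)..2 * Real.pi, pt (energyDensity u) t x ≤ C * E t := by
    intro t ht
    have hint : ∫ x in (0 : ℝ)..2 * Real.pi, pt (energyDensity u) t x
        = ∫ x in (0 : ℝ)..2 * Real.pi,
            (pt (energyDensity u) t x - px (fun t x => 2 * pt u t x ^ 2) t x) := by
      rw [intervalIntegral.integral_sub
        ((hu.energyDensity.pt.continuous_snd t).intervalIntegrable _ _)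
        ((hφ.px.continuous_snd t).intervalIntegrable _ _), integral_px_eq_zero hφ hφp, sub_zero]
    rw [hint, ← intervalIntegral.integral_const_mul]
    refine intervalIntegral.integral_mono Real.two_pi_pos.le
      (((hu.energyDensity.pt.continuous_snd t).sub
        (hφ.px.continuous_snd t)).intervalIntegrable _ _)
      (((hu.energyDensity.continuous_snd t).const_mul C).intervalIntegrable _ _) fun x => ?_
    have htT := Set.Ioo_subset_Icc_self ht
    have hP := heq t x ht.1
    unfold MisnerP at hP
    refine le_trans (le_of_eq ?_) (energy_flux_le (p := pt u t x)
      (q := t * pt u t x - 2 * px u t x) (s := u t x) ht.1.le ht.2.le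
      (by positivity) ((haK t htT x).trans (by linarith)) ((hbK t htT x).trans (by linarith))
      ((hcK t htT x).trans (by linarith)) hM (hbM' t htT x))
    simp only [pt_energyDensity hu, hpx]
    linear_combination (2 * pt u t x + 2 * (t * pt u t x - 2 * px u t x)) * hP
  have hder : ∀ t, HasDerivAt (fun t => E t * Real.exp (-C * t))
      ((∫ x in (0 : ℝ)..2 * Real.pi, pt (energyDensity u) t x) * Real.exp (-C * t)
        + E t * (Real.exp (-C * t) * (-C))) t := fun t =>
    (hu.energyDensity.hasDerivAt_integral t).mul
      (by simpa using ((hasDerivAt_id t).const_mul (-C)).exp)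
  have hanti : AntitoneOn (fun t => E t * Real.exp (-C * t)) (Set.Icc 0 T) := by
    refine antitoneOn_of_deriv_nonpos (convex_Icc 0 T)
      (fun t _ => (hder t).continuousAt.continuousWithinAt)
      (fun t _ => (hder t).differentiableAt.differentiableWithinAt) fun t ht => ?_
    rw [interior_Icc] at ht
    rw [(hder t).deriv]
    nlinarith [mul_le_mul_of_nonneg_right (hE' t ht) (Real.exp_pos (-C * t)).le]
  have hE0 : E 0 = 0 := by
    have hx : ∀ x, px u 0 x = 0 := fun x => by simp [px, h0]
    simp [E, energyDensity, hx, h0]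
  have h := hanti (Set.left_mem_Icc.2 hT) (Set.right_mem_Icc.2 hT) hT
  simp only [hE0, zero_mul] at h
  exact nonpos_of_mul_nonpos_left h (Real.exp_pos _)

/-- Uniqueness for admissible wave equations on the Misner spacetime, with data
only on the Cauchy horizon. -/
theorem stmt2 (a b c : ℝ → ℝ → ℝ)
    (ha : Smooth2 a) (hap : Periodic2 a)
    (hb : Smooth2 b) (hbp : Periodic2 b)
    (hc : Smooth2 c) (hcp : Periodic2 c)
    (hadm : ∀ x : ℝ, 0 ≤ b 0 x)
    (u : ℝ → ℝ → ℝ) (hu : Smooth2 u) (hup : Periodic2 u)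
    (heq : ∀ t x : ℝ, 0 < t → MisnerP a b c u t x = 0)
    (h0 : ∀ x : ℝ, u 0 x = 0) :
    ∀ t x : ℝ, 0 ≤ t → u t x = 0 := by
  intro t x ht
  obtain ⟨y, hy, hxy⟩ := Function.Periodic.exists_mem_Ico₀ (f := u t) (hup t)
    Real.two_pi_pos x
  rw [hxy]
  by_contra hne
  have hnn : ∀ z, u t z ^ 2 ≤ energyDensity u t z := fun z => by
    unfold energyDensity
    have : 0 ≤ t * pt u t z ^ 2 + (t * pt u t z - 2 * px u t z) ^ 2 := by positivity
    linarith
  refine absurd (integral_energyDensity_nonpos ha hap hb hbp hc hcp hadm hu hup heq h0 ht)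
    (not_le.2 (intervalIntegral.integral_pos Real.two_pi_pos
      (hu.energyDensity.continuous_snd t).continuousOn
      (fun z _ => (sq_nonneg _).trans (hnn z))
      ⟨y, Set.Ico_subset_Icc_self hy, (sq_pos_of_ne_zero hne).trans_le (hnn y)⟩))
end
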